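/- arXiv:2202.05192 — 6 statements merged into one kernel-verified Lean document; each statement's English description precedes it below -/
import Mathlib

section
/- If x ∈ ℝ^p is distributed as a p-variate von Mises–Fisher random vector with concentration κ > 0 and mean direction μ (‖μ‖₂ = 1), then its variance matrix is Variance(x) = ∫_{S_p} x x' f_p(x;κ,μ) dσ(x) − (r_ν(κ)μ)(r_ν(κ)μ)' = (r_ν(κ)/κ)·I_p + (1 − (p/κ)·r_ν(κ) − r_ν(κ)²)·μμ', where I_p is the p×p identity matrix and r_ν(κ) = I_{ν+1}(κ)/I_ν(κ). -/
open MeasureTheory Real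
open scoped RealInnerProductSpace

/-- `ν = p/2 − 1`. -/
noncomputable def nuOf (p : ℕ) : ℝ := (p : ℝ) / 2 - 1

/-- The modified Bessel function of the first kind,
`I_ν(z) = (z/2)^ν ∑_{k=0}^∞ (z/2)^{2k}/(k!·Γ(ν+k+1))`. -/
noncomputable def besselI (ν z : ℝ) : ℝ :=
  (z / 2) ^ ν * ∑' k : ℕ, (z / 2) ^ (2 * k) / (Nat.factorial k * Real.Gamma (ν + k + 1))

/-- The ratio of modified Bessel functions `r_ν(κ) = I_{ν+1}(κ)/I_ν(κ)`. -/
noncomputable def besselRatio (ν κ : ℝ) : ℝ := besselI (ν + 1) κ / besselI ν κ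

/-- The standard surface measure on the unit sphere in `ℝ^p`. -/
noncomputable def sphereMeasure (p : ℕ) :
    Measure (Metric.sphere (0 : EuclideanSpace ℝ (Fin p)) 1) :=
  (volume : Measure (EuclideanSpace ℝ (Fin p))).toSphere

/-- The von Mises–Fisher partition function `C_ν(κ) = (2π)^{ν+1} I_ν(κ)/κ^ν`. -/
noncomputable def vmfC (ν κ : ℝ) : ℝ := (2 * Real.pi) ^ (ν + 1) * besselI ν κ / κ ^ ν

/-- The von Mises–Fisher density `f_p(x;κ,μ) = exp(κ⟨μ,x⟩)/C_ν(κ)`. -/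
noncomputable def vmf (p : ℕ) (κ : ℝ) (μ x : EuclideanSpace ℝ (Fin p)) : ℝ :=
  Real.exp (κ * ⟪μ, x⟫) / vmfC (nuOf p) κ

/-- The uniform density on the unit sphere in `ℝ^p`, `u(x) = Γ(ν+1)/(2π^{ν+1})`. -/
noncomputable def uniformDensity (p : ℕ) : ℝ :=
  Real.Gamma (nuOf p + 1) / (2 * Real.pi ^ (nuOf p + 1))

section helpers

lemma vmfaux_polar {p : ℕ} (hp0 : 0 < p) (f : EuclideanSpace ℝ (Fin p) → ℝ) (h : ℝ → ℝ) :
    ∫ x : EuclideanSpace ℝ (Fin p), f (‖x‖⁻¹ • x) * h ‖x‖ =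
      (∫ x : Metric.sphere (0 : EuclideanSpace ℝ (Fin p)) 1, f x ∂(sphereMeasure p)) *
        ∫ y in Set.Ioi (0 : ℝ), y ^ (p - 1) * h y := by
  have : Nonempty (Fin p) := ⟨⟨0, hp0⟩⟩
  have hd : Module.finrank ℝ (EuclideanSpace ℝ (Fin p)) = p := by simp
  calc
    _ = ∫ x : ({(0)}ᶜ : Set (EuclideanSpace ℝ (Fin p))), f (‖x.1‖⁻¹ • x.1) * h ‖x.1‖
          ∂(volume.comap Subtype.val) := by
      rw [integral_subtype_comap (measurableSet_singleton _).compl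
        fun x : EuclideanSpace ℝ (Fin p) ↦ f (‖x‖⁻¹ • x) * h ‖x‖,
        restrict_compl_singleton]
    _ = ∫ x, f x.1 * h x.2 ∂(sphereMeasure p).prod (.volumeIoiPow (p - 1)) := by
      have := (volume : Measure (EuclideanSpace ℝ (Fin p))).measurePreserving_homeomorphUnitSphereProd.integral_comp
        (Homeomorph.measurableEmbedding _) (fun x => f x.1 * h x.2)
      rw [hd] at this
      simpa [sphereMeasure] using this
    _ = (∫ x : Metric.sphere (0 : EuclideanSpace ℝ (Fin p)) 1, f x ∂(sphereMeasure p)) *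
          ∫ x : Set.Ioi (0 : ℝ), h x ∂(.volumeIoiPow (p - 1)) := by
      have : IsFiniteMeasure (sphereMeasure p) := by unfold sphereMeasure; infer_instance
      exact integral_prod_mul (fun x : Metric.sphere (0 : EuclideanSpace ℝ (Fin p)) 1 => f x)
        (fun x : Set.Ioi (0 : ℝ) => h x)
    _ = _ := by
      congr 1
      simp only [Measure.volumeIoiPow, ENNReal.ofReal]
      rw [integral_withDensity_eq_integral_smul,
        integral_subtype_comap measurableSet_Ioi fun a ↦ Real.toNNReal (a ^ (p - 1)) • h a,
        setIntegral_congr_fun measurableSet_Ioi fun x hx ↦ ?_]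
      · rw [NNReal.smul_def, Real.coe_toNNReal _ (pow_nonneg hx.out.le _), smul_eq_mul]
      · exact (measurable_subtype_coe.pow_const _).real_toNNReal

lemma vmfaux_radial (n k : ℕ) :
    ∫ y in Set.Ioi (0 : ℝ), y ^ n * (y ^ (2 * k) * Real.exp (-y ^ 2)) =
      Real.Gamma (k + (n + 1) / 2) / 2 := by
  have := integral_rpow_mul_exp_neg_rpow (p := 2) (q := (n + 2 * k : ℕ)) (by norm_num)
    (by have : (0 : ℝ) ≤ ((n + 2 * k : ℕ) : ℝ) := by positivity
        linarith)
  rw [show Real.Gamma (k + (n + 1) / 2) / 2 = 1 / 2 * Real.Gamma (((n + 2 * k : ℕ) + 1) / 2) by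
    push_cast; rw [show ((k : ℝ) + (n + 1) / 2) = (n + 2 * k + 1) / 2 by ring]; ring, ← this]
  refine setIntegral_congr_fun measurableSet_Ioi fun x hx ↦ ?_
  simp only [Real.rpow_natCast, Real.rpow_two]
  ring

lemma vmfaux_line (k : ℕ) :
    ∫ y : ℝ, y ^ (2 * k) * Real.exp (-y ^ 2) = Real.Gamma (k + 1 / 2) := by
  have h := integral_comp_abs (f := fun y : ℝ => y ^ (2 * k) * Real.exp (-y ^ 2))
  have h2 := vmfaux_radial 0 k
  simp only [pow_zero, one_mul, Nat.cast_zero, zero_add] at h2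
  rw [h2] at h
  simp only [sq_abs, pow_mul] at h ⊢
  rw [h]; ring

lemma vmfaux_gauss {p : ℕ} (i : Fin p) (k : ℕ) :
    ∫ x : EuclideanSpace ℝ (Fin p), (x i) ^ (2 * k) * Real.exp (-‖x‖ ^ 2) =
      Real.Gamma (k + 1 / 2) * √π ^ (p - 1) := by
  have h1 := (PiLp.volume_preserving_toLp (Fin p)).integral_comp
    (MeasurableEquiv.toLp 2 (Fin p → ℝ)).measurableEmbedding
    (fun x : EuclideanSpace ℝ (Fin p) => (x i) ^ (2 * k) * Real.exp (-‖x‖ ^ 2))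
  rw [← h1]
  have h2 : ∀ x : Fin p → ℝ, (x i) ^ (2 * k) * Real.exp (-‖WithLp.toLp 2 x‖ ^ 2) =
      ∏ j, ((x j) ^ (2 * (if j = i then k else 0)) * Real.exp (-(x j) ^ 2)) := by
    intro x
    rw [Finset.prod_mul_distrib, ← Real.exp_sum, EuclideanSpace.norm_sq_eq]
    congr 1
    · rw [Finset.prod_eq_single i]
      · simp
      · intro b _ hb; simp [hb]
      · simp
    · simp
  simp only [h2]
  rw [integral_fintype_prod_volume_eq_prod
    (f := fun j (y : ℝ) => y ^ (2 * (if j = i then k else 0)) * Real.exp (-y ^ 2))]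
  simp only [vmfaux_line]
  rw [← Finset.mul_prod_erase _ _ (Finset.mem_univ i)]
  congr 1
  · simp
  · rw [Finset.prod_congr rfl (g := fun _ => √π)]
    · simp
    · intro j hj
      rw [if_neg (Finset.ne_of_mem_erase hj)]
      simp [← Real.Gamma_one_half_eq]

/-- invariance of the sphere measure. -/
lemma vmfaux_inv {p : ℕ} (hp : 0 < p) (T : EuclideanSpace ℝ (Fin p) ≃ₗᵢ[ℝ] EuclideanSpace ℝ (Fin p))
    (f : EuclideanSpace ℝ (Fin p) → ℝ) :
    ∫ x : Metric.sphere (0 : EuclideanSpace ℝ (Fin p)) 1, f (T x) ∂(sphereMeasure p) =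
    ∫ x : Metric.sphere (0 : EuclideanSpace ℝ (Fin p)) 1, f x ∂(sphereMeasure p) := by
  have h1 := vmfaux_polar hp (fun x => f (T x)) (fun y => y ^ (2 * 0) * Real.exp (-y ^ 2))
  have h2 := vmfaux_polar hp f (fun y => y ^ (2 * 0) * Real.exp (-y ^ 2))
  have h3 := T.measurePreserving.integral_comp T.toHomeomorph.measurableEmbedding
    (fun x => f (‖x‖⁻¹ • x) * (‖x‖ ^ (2 * 0) * Real.exp (-‖x‖ ^ 2)))
  simp only [LinearIsometryEquiv.norm_map, ← map_smul] at h3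
  rw [h3, h2, vmfaux_radial] at h1
  refine (mul_right_cancel₀ ?_ h1).symm
  have : 0 < Real.Gamma (((0 : ℕ) : ℝ) + ((p - 1 : ℕ) + 1) / 2) := Real.Gamma_pos_of_pos (by positivity)
  positivity

/-- even moments. -/
lemma vmfaux_moment {p : ℕ} (hp : 0 < p) (μ : EuclideanSpace ℝ (Fin p)) (hμ : ‖μ‖ = 1) (k : ℕ) :
    (∫ x : Metric.sphere (0 : EuclideanSpace ℝ (Fin p)) 1, ⟪μ, (x : EuclideanSpace ℝ (Fin p))⟫ ^ (2 * k)
      ∂(sphereMeasure p)) * Real.Gamma (k + p / 2) =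
      2 * √π ^ (p - 1) * Real.Gamma (k + 1 / 2) := by
  let i : Fin p := ⟨0, hp⟩
  let e : EuclideanSpace ℝ (Fin p) := EuclideanSpace.single i 1
  have he : ‖μ‖ = ‖e‖ := by simp [e, hμ]
  let T := (ℝ ∙ (μ - e))ᗮ.reflection
  have hT : T μ = e := Submodule.reflection_sub he
  have h1 := vmfaux_inv hp T (fun x => ⟪e, x⟫ ^ (2 * k))
  simp only [← hT, LinearIsometryEquiv.inner_map_map] at h1
  rw [h1, hT]
  have h2 := vmfaux_polar hp (fun x : EuclideanSpace ℝ (Fin p) => ⟪e, x⟫ ^ (2 * k)) (fun y => y ^ (2 * k) * Real.exp (-y ^ 2))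
  rw [vmfaux_radial] at h2
  have h3 : ∀ x : EuclideanSpace ℝ (Fin p), ⟪e, ‖x‖⁻¹ • x⟫ ^ (2 * k) * (‖x‖ ^ (2 * k) * Real.exp (-‖x‖ ^ 2)) =
    (x i) ^ (2 * k) * Real.exp (-‖x‖ ^ 2) := by
    intro x
    have : ⟪e, x⟫ = x i := by simp [e, EuclideanSpace.inner_single_left]
    rw [inner_smul_right, ← mul_assoc, ← mul_pow, this]
    rcases eq_or_ne x 0 with rfl | hx
    · simp
    · have : ‖x‖ ≠ 0 := by simpa using hx
      congr 2
      field_simp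
  simp only [h3] at h2
  rw [vmfaux_gauss] at h2
  have hc : (((p - 1 : ℕ) : ℝ) + 1) = p := by
    rw [Nat.cast_sub (by omega)]; simp
  rw [hc] at h2
  linarith

lemma vmfaux_integrable {p : ℕ} (f : EuclideanSpace ℝ (Fin p) → ℝ) (hf : Continuous f) :
    Integrable (fun x : Metric.sphere (0 : EuclideanSpace ℝ (Fin p)) 1 => f x) (sphereMeasure p) := by
  have : IsFiniteMeasure (sphereMeasure p) := by unfold sphereMeasure; infer_instance
  exact (hf.comp continuous_subtype_val).integrable_of_hasCompactSupport
    (HasCompactSupport.of_compactSpace _)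

lemma vmfaux_series {p : ℕ} (κ : ℝ) (μ : EuclideanSpace ℝ (Fin p)) (hμ : ‖μ‖ = 1)
    (g : EuclideanSpace ℝ (Fin p) → ℝ) (hg : Continuous g)
    (hg1 : ∀ x : EuclideanSpace ℝ (Fin p), ‖x‖ = 1 → |g x| ≤ 1) :
    HasSum (fun k : ℕ => κ ^ (2 * k) / (2 * k).factorial *
      ∫ x : Metric.sphere (0 : EuclideanSpace ℝ (Fin p)) 1,
        g x * ⟪μ, (x : EuclideanSpace ℝ (Fin p))⟫ ^ (2 * k) ∂(sphereMeasure p))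
      (∫ x : Metric.sphere (0 : EuclideanSpace ℝ (Fin p)) 1,
        g x * Real.cosh (κ * ⟪μ, (x : EuclideanSpace ℝ (Fin p))⟫) ∂(sphereMeasure p)) := by
  have hfin : IsFiniteMeasure (sphereMeasure p) := by unfold sphereMeasure; infer_instance
  have h := hasSum_integral_of_dominated_convergence (μ := sphereMeasure p)
    (F := fun (k : ℕ) (x : Metric.sphere (0 : EuclideanSpace ℝ (Fin p)) 1) =>
      κ ^ (2 * k) / (2 * k).factorial * (g x * ⟪μ, (x : EuclideanSpace ℝ (Fin p))⟫ ^ (2 * k)))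
    (f := fun x => g x * Real.cosh (κ * ⟪μ, (x : EuclideanSpace ℝ (Fin p))⟫))
    (fun k _ => κ ^ (2 * k) / (2 * k).factorial) ?_ ?_ ?_ ?_ ?_
  · simpa only [integral_const_mul] using h
  · intro k
    exact (vmfaux_integrable (fun x => κ ^ (2 * k) / (2 * k).factorial *
      (g x * ⟪μ, x⟫ ^ (2 * k))) (by fun_prop)).aestronglyMeasurable
  · intro k
    refine Filter.Eventually.of_forall fun x => ?_
    have hx : ‖(x : EuclideanSpace ℝ (Fin p))‖ = 1 := by simp
    have h0 : 0 ≤ κ ^ (2 * k) / (2 * k).factorial := by rw [pow_mul]; positivity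
    have h1 : |⟪μ, (x : EuclideanSpace ℝ (Fin p))⟫| ≤ 1 := by
      have := abs_real_inner_le_norm μ (x : EuclideanSpace ℝ (Fin p))
      rwa [hμ, hx, one_mul] at this
    rw [Real.norm_eq_abs, abs_mul, abs_of_nonneg h0, abs_mul, abs_pow]
    have h2 := pow_le_one₀ (n := 2 * k) (abs_nonneg _) h1
    have h3 := mul_le_one₀ (hg1 x hx) (by positivity) h2
    exact mul_le_of_le_one_right h0 h3
  · exact Filter.Eventually.of_forall fun x => (Real.hasSum_cosh κ).summable
  · exact integrable_const _
  · refine Filter.Eventually.of_forall fun x => ?_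
    have := (Real.hasSum_cosh (κ * ⟪μ, (x : EuclideanSpace ℝ (Fin p))⟫)).mul_left (g x)
    refine this.congr_fun ?_
    intro k
    rw [mul_pow]; ring

lemma vmfaux_cosh {p : ℕ} (hp : 0 < p) (κ : ℝ) (μ : EuclideanSpace ℝ (Fin p))
    (g : EuclideanSpace ℝ (Fin p) → ℝ) (hg : Continuous g) (hge : ∀ x, g (-x) = g x) :
    (∫ x : Metric.sphere (0 : EuclideanSpace ℝ (Fin p)) 1,
        g x * Real.cosh (κ * ⟪μ, (x : EuclideanSpace ℝ (Fin p))⟫) ∂(sphereMeasure p)) =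
    ∫ x : Metric.sphere (0 : EuclideanSpace ℝ (Fin p)) 1,
        g x * Real.exp (κ * ⟪μ, (x : EuclideanSpace ℝ (Fin p))⟫) ∂(sphereMeasure p) := by
  have h1 := vmfaux_inv hp (LinearIsometryEquiv.neg ℝ) (fun x => g x * Real.exp (κ * ⟪μ, x⟫))
  simp only [LinearIsometryEquiv.coe_neg, inner_neg_right, hge, mul_neg] at h1
  have h2 : ∀ x : Metric.sphere (0 : EuclideanSpace ℝ (Fin p)) 1,
      g x * Real.cosh (κ * ⟪μ, (x : EuclideanSpace ℝ (Fin p))⟫) =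
      (1 / 2) * (g x * Real.exp (κ * ⟪μ, (x : EuclideanSpace ℝ (Fin p))⟫) +
      g x * Real.exp (-(κ * ⟪μ, (x : EuclideanSpace ℝ (Fin p))⟫))) := by
    intro x; rw [Real.cosh_eq]; ring
  simp only [h2]
  rw [integral_const_mul, integral_add, h1]
  · ring
  · exact vmfaux_integrable (fun x => g x * Real.exp (κ * ⟪μ, x⟫)) (by fun_prop)
  · exact vmfaux_integrable (fun x => g x * Real.exp (-(κ * ⟪μ, x⟫))) (by fun_prop)

lemma vmfaux_Gamma_half (k : ℕ) :
    Real.Gamma (k + 1 / 2) * (4 ^ k * k.factorial) = (2 * k).factorial * √π := by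
  induction k with
  | zero => simp [← Real.Gamma_one_half_eq]
  | succ k ih =>
    have h : ((k + 1 : ℕ) : ℝ) + 1 / 2 = (k + 1 / 2) + 1 := by push_cast; ring
    rw [h, Real.Gamma_add_one (by positivity), show 2 * (k + 1) = (2 * k + 1) + 1 by ring,
      Nat.factorial_succ, Nat.factorial_succ, Nat.factorial_succ]
    push_cast
    linear_combination (4 * (k + 1 / 2) * (k + 1)) * ih

lemma vmfaux_term {p : ℕ} (hp : 0 < p) (κ : ℝ) (μ : EuclideanSpace ℝ (Fin p)) (hμ : ‖μ‖ = 1) (k : ℕ) :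
    κ ^ (2 * k) / (2 * k).factorial *
      (∫ x : Metric.sphere (0 : EuclideanSpace ℝ (Fin p)) 1,
        ⟪μ, (x : EuclideanSpace ℝ (Fin p))⟫ ^ (2 * k) ∂(sphereMeasure p)) =
    2 * √π ^ p * ((κ / 2) ^ (2 * k) / (k.factorial * Real.Gamma (k + p / 2))) := by
  have hm := vmfaux_moment hp μ hμ k
  have hG := vmfaux_Gamma_half k
  have hpos : 0 < Real.Gamma ((k : ℝ) + p / 2) := Real.Gamma_pos_of_pos (by positivity)
  rw [eq_div_of_mul_eq hpos.ne' hm, eq_div_of_mul_eq (by positivity) hG]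
  obtain ⟨q, rfl⟩ : ∃ q, p = q + 1 := ⟨p - 1, by omega⟩
  rw [Nat.add_sub_cancel, div_pow, pow_mul 2 2 k, pow_succ √π q]
  norm_num
  field_simp

lemma vmfaux_C {p : ℕ} (hp : 0 < p) (κ : ℝ) (μ : EuclideanSpace ℝ (Fin p)) (hμ : ‖μ‖ = 1) :
    HasSum (fun k : ℕ => 2 * √π ^ p * ((κ / 2) ^ (2 * k) / (k.factorial * Real.Gamma (k + p / 2))))
      (∫ x : Metric.sphere (0 : EuclideanSpace ℝ (Fin p)) 1,
        Real.exp (κ * ⟪μ, (x : EuclideanSpace ℝ (Fin p))⟫) ∂(sphereMeasure p)) := by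
  have h := vmfaux_series κ μ hμ (fun _ => 1) continuous_const (by simp)
  rw [vmfaux_cosh hp κ μ (fun _ => 1) continuous_const (by simp)] at h
  simp only [one_mul, vmfaux_term hp κ μ hμ] at h
  exact h

lemma vmfaux_D {p : ℕ} (hp : 0 < p) (κ : ℝ) (μ : EuclideanSpace ℝ (Fin p)) (hμ : ‖μ‖ = 1) :
    HasSum (fun k : ℕ => ((p : ℝ) - 1) * √π ^ p *
        ((κ / 2) ^ (2 * k) / (k.factorial * Real.Gamma (k + p / 2 + 1))))
      (∫ x : Metric.sphere (0 : EuclideanSpace ℝ (Fin p)) 1,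
        (1 - ⟪μ, (x : EuclideanSpace ℝ (Fin p))⟫ ^ 2) *
        Real.exp (κ * ⟪μ, (x : EuclideanSpace ℝ (Fin p))⟫) ∂(sphereMeasure p)) := by
  have h := vmfaux_series κ μ hμ (fun x => 1 - ⟪μ, x⟫ ^ 2) (by fun_prop) (by
    intro x hx
    have := abs_real_inner_le_norm μ x
    rw [hμ, hx, one_mul] at this
    have h2 := (sq_le_one_iff_abs_le_one _).2 this
    rw [abs_le]; constructor <;> nlinarith [sq_nonneg ⟪μ, x⟫])
  rw [vmfaux_cosh hp κ μ (fun x => 1 - ⟪μ, x⟫ ^ 2) (by fun_prop) (by simp)] at h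
  refine h.congr_fun ?_
  intro k
  have h1 : (∫ x : Metric.sphere (0 : EuclideanSpace ℝ (Fin p)) 1,
      (1 - ⟪μ, (x : EuclideanSpace ℝ (Fin p))⟫ ^ 2) * ⟪μ, (x : EuclideanSpace ℝ (Fin p))⟫ ^ (2 * k)
        ∂(sphereMeasure p)) =
      (∫ x : Metric.sphere (0 : EuclideanSpace ℝ (Fin p)) 1,
        ⟪μ, (x : EuclideanSpace ℝ (Fin p))⟫ ^ (2 * k) ∂(sphereMeasure p)) -
      (∫ x : Metric.sphere (0 : EuclideanSpace ℝ (Fin p)) 1,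
        ⟪μ, (x : EuclideanSpace ℝ (Fin p))⟫ ^ (2 * (k + 1)) ∂(sphereMeasure p)) := by
    rw [← integral_sub]
    · congr 1; ext x; ring
    · exact vmfaux_integrable (fun x => ⟪μ, x⟫ ^ (2 * k)) (by fun_prop)
    · exact vmfaux_integrable (fun x => ⟪μ, x⟫ ^ (2 * (k + 1))) (by fun_prop)
  have hm := vmfaux_moment hp μ hμ k
  have hm' := vmfaux_moment hp μ hμ (k + 1)
  have ht := vmfaux_term hp κ μ hμ k
  have hpos : 0 < Real.Gamma ((k : ℝ) + p / 2) := Real.Gamma_pos_of_pos (by positivity)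
  have hkp : (0 : ℝ) < k + p / 2 := by positivity
  have e1 : ((k + 1 : ℕ) : ℝ) + p / 2 = (k + p / 2) + 1 := by push_cast; ring
  have e2 : ((k + 1 : ℕ) : ℝ) + 1 / 2 = (k + 1 / 2) + 1 := by push_cast; ring
  rw [e1, e2, Real.Gamma_add_one hkp.ne', Real.Gamma_add_one (by positivity)] at hm'
  rw [h1, Real.Gamma_add_one hkp.ne']
  generalize (∫ x : Metric.sphere (0 : EuclideanSpace ℝ (Fin p)) 1,
        ⟪μ, (x : EuclideanSpace ℝ (Fin p))⟫ ^ (2 * k) ∂(sphereMeasure p)) = m at *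
  generalize (∫ x : Metric.sphere (0 : EuclideanSpace ℝ (Fin p)) 1,
        ⟪μ, (x : EuclideanSpace ℝ (Fin p))⟫ ^ (2 * (k + 1)) ∂(sphereMeasure p)) = m' at *
  have h3 : m' * (k + p / 2) = m * (k + 1 / 2) := by
    apply mul_right_cancel₀ hpos.ne'
    linear_combination hm' - (k + 1 / 2) * hm
  have h4 : m' = m * (k + 1 / 2) / (k + p / 2) := eq_div_of_mul_eq hkp.ne' h3
  have h5 : m - m' = m * ((p - 1) / 2 / (k + p / 2)) := by
    rw [h4]; field_simp; ring
  rw [h5, ← mul_assoc (κ ^ (2 * k) / ((2 * k).factorial : ℝ)) m, ht]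
  field_simp

/-- The weighted second moment form. -/
noncomputable def vmfB {p : ℕ} (κ : ℝ) (μ u v : EuclideanSpace ℝ (Fin p)) : ℝ :=
  ∫ x : Metric.sphere (0 : EuclideanSpace ℝ (Fin p)) 1,
    ⟪u, (x : EuclideanSpace ℝ (Fin p))⟫ * ⟪v, (x : EuclideanSpace ℝ (Fin p))⟫ *
      Real.exp (κ * ⟪μ, (x : EuclideanSpace ℝ (Fin p))⟫) ∂(sphereMeasure p)

lemma vmfB_symm {p : ℕ} (κ : ℝ) (μ u v : EuclideanSpace ℝ (Fin p)) :
    vmfB κ μ u v = vmfB κ μ v u := by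
  unfold vmfB; congr 1; ext x; ring

lemma vmfB_integrable {p : ℕ} (κ : ℝ) (μ u v : EuclideanSpace ℝ (Fin p)) :
    Integrable (fun x : Metric.sphere (0 : EuclideanSpace ℝ (Fin p)) 1 =>
      ⟪u, (x : EuclideanSpace ℝ (Fin p))⟫ * ⟪v, (x : EuclideanSpace ℝ (Fin p))⟫ *
      Real.exp (κ * ⟪μ, (x : EuclideanSpace ℝ (Fin p))⟫)) (sphereMeasure p) :=
  vmfaux_integrable (fun x => ⟪u, x⟫ * ⟪v, x⟫ * Real.exp (κ * ⟪μ, x⟫)) (by fun_prop)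

lemma vmfB_add {p : ℕ} (κ : ℝ) (μ u u' v : EuclideanSpace ℝ (Fin p)) :
    vmfB κ μ (u + u') v = vmfB κ μ u v + vmfB κ μ u' v := by
  unfold vmfB
  rw [← integral_add (vmfB_integrable _ _ _ _) (vmfB_integrable _ _ _ _)]
  congr 1; ext x; rw [inner_add_left]; ring

lemma vmfB_smul {p : ℕ} (κ c : ℝ) (μ u v : EuclideanSpace ℝ (Fin p)) :
    vmfB κ μ (c • u) v = c * vmfB κ μ u v := by
  unfold vmfB
  rw [← integral_const_mul]
  congr 1; ext x; rw [real_inner_smul_left]; ring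

lemma vmfB_add_right {p : ℕ} (κ : ℝ) (μ u v v' : EuclideanSpace ℝ (Fin p)) :
    vmfB κ μ u (v + v') = vmfB κ μ u v + vmfB κ μ u v' := by
  rw [vmfB_symm, vmfB_add, vmfB_symm κ μ v, vmfB_symm κ μ v']

lemma vmfB_smul_right {p : ℕ} (κ c : ℝ) (μ u v : EuclideanSpace ℝ (Fin p)) :
    vmfB κ μ u (c • v) = c * vmfB κ μ u v := by
  rw [vmfB_symm, vmfB_smul, vmfB_symm]

lemma vmfB_map {p : ℕ} (hp : 0 < p) (κ : ℝ) (μ u v : EuclideanSpace ℝ (Fin p))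
    (T : EuclideanSpace ℝ (Fin p) ≃ₗᵢ[ℝ] EuclideanSpace ℝ (Fin p)) :
    vmfB κ (T μ) (T u) (T v) = vmfB κ μ u v := by
  have h := vmfaux_inv hp T (fun x => ⟪T u, x⟫ * ⟪T v, x⟫ * Real.exp (κ * ⟪T μ, x⟫))
  simp only [LinearIsometryEquiv.inner_map_map] at h
  exact h.symm

lemma vmfB_cross {p : ℕ} (hp : 0 < p) (κ : ℝ) (μ u : EuclideanSpace ℝ (Fin p)) (hu : ⟪μ, u⟫ = 0) :
    vmfB κ μ u μ = 0 := by
  have h := vmfB_map hp κ μ u μ (ℝ ∙ μ).reflection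
  have h1 : (ℝ ∙ μ).reflection μ = μ :=
    Submodule.reflection_mem_subspace_eq_self (Submodule.mem_span_singleton_self μ)
  have h2 : (ℝ ∙ μ).reflection u = -u :=
    Submodule.reflection_mem_subspace_orthogonalComplement_eq_neg
      (Submodule.mem_orthogonal_singleton_iff_inner_right.2 hu)
  rw [h1, h2, ← neg_one_smul ℝ u, vmfB_smul] at h
  linarith

lemma vmfB_norm {p : ℕ} (hp : 0 < p) (κ : ℝ) (μ u v : EuclideanSpace ℝ (Fin p)) (hu : ⟪μ, u⟫ = 0)
    (hv : ⟪μ, v⟫ = 0) (huv : ‖u‖ = ‖v‖) :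
    vmfB κ μ u u = vmfB κ μ v v := by
  have h := vmfB_map hp κ μ u u (ℝ ∙ (u - v))ᗮ.reflection
  have h1 : (ℝ ∙ (u - v))ᗮ.reflection μ = μ :=
    Submodule.reflection_mem_subspace_eq_self
      (Submodule.mem_orthogonal_singleton_iff_inner_left.2 (by rw [inner_sub_right, hu, hv, sub_zero]))
  rw [h1, Submodule.reflection_sub huv] at h
  exact h.symm

lemma vmfB_norm' {p : ℕ} (hp : 0 < p) (κ : ℝ) (μ u v : EuclideanSpace ℝ (Fin p)) (hu : ⟪μ, u⟫ = 0)
    (hv : ⟪μ, v⟫ = 0) :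
    ‖v‖ ^ 2 * vmfB κ μ u u = ‖u‖ ^ 2 * vmfB κ μ v v := by
  have h := vmfB_norm hp κ μ (‖v‖ • u) (‖u‖ • v) (by rw [inner_smul_right, hu, mul_zero])
    (by rw [inner_smul_right, hv, mul_zero]) (by simp [norm_smul, mul_comm])
  simp only [vmfB_smul, vmfB_smul_right] at h
  linear_combination h

lemma vmfB_main {p : ℕ} (hp : 2 ≤ p) (κ a : ℝ) (μ : EuclideanSpace ℝ (Fin p)) (hμ : ‖μ‖ = 1)
    (ha : (∫ x : Metric.sphere (0 : EuclideanSpace ℝ (Fin p)) 1,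
        (1 - ⟪μ, (x : EuclideanSpace ℝ (Fin p))⟫ ^ 2) *
        Real.exp (κ * ⟪μ, (x : EuclideanSpace ℝ (Fin p))⟫) ∂(sphereMeasure p)) = (p - 1) * a)
    (i j : Fin p) :
    vmfB κ μ (EuclideanSpace.single i 1) (EuclideanSpace.single j 1) =
      a * (if i = j then 1 else 0) +
      ((∫ x : Metric.sphere (0 : EuclideanSpace ℝ (Fin p)) 1,
        Real.exp (κ * ⟪μ, (x : EuclideanSpace ℝ (Fin p))⟫) ∂(sphereMeasure p)) - p * a) *
        (μ i * μ j) := by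
  have hp0 : 0 < p := by omega
  set C := ∫ x : Metric.sphere (0 : EuclideanSpace ℝ (Fin p)) 1,
        Real.exp (κ * ⟪μ, (x : EuclideanSpace ℝ (Fin p))⟫) ∂(sphereMeasure p) with hC
  have hCint : Integrable (fun x : Metric.sphere (0 : EuclideanSpace ℝ (Fin p)) 1 =>
      Real.exp (κ * ⟪μ, (x : EuclideanSpace ℝ (Fin p))⟫)) (sphereMeasure p) :=
    vmfaux_integrable (fun x => Real.exp (κ * ⟪μ, x⟫)) (by fun_prop)
  have hCB : C - vmfB κ μ μ μ = (p - 1) * a := by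
    rw [← ha, hC, vmfB, ← integral_sub hCint (vmfB_integrable _ _ _ _)]
    congr 1; ext x; ring
  let e : Fin p → EuclideanSpace ℝ (Fin p) := fun i => EuclideanSpace.single i 1
  let u : Fin p → EuclideanSpace ℝ (Fin p) := fun i => e i - μ i • μ
  have hμμ : ⟪μ, μ⟫ = 1 := by rw [real_inner_self_eq_norm_sq, hμ]; norm_num
  have heμ : ∀ i, ⟪μ, e i⟫ = μ i := by intro i; simp [e, EuclideanSpace.inner_single_right]
  have hex : ∀ i (x : EuclideanSpace ℝ (Fin p)), ⟪e i, x⟫ = x i := by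
    intro i x; simp [e, EuclideanSpace.inner_single_left]
  have hee : ∀ i j, ⟪e i, e j⟫ = if i = j then 1 else 0 := by
    intro i j; rw [hex]; simp [e, Pi.single_apply]
  have hu : ∀ i, ⟪μ, u i⟫ = 0 := by
    intro i
    simp only [u, inner_sub_right, inner_smul_right, heμ, hμμ]; ring
  have huu : ∀ i j, ⟪u i, u j⟫ = (if i = j then 1 else 0) - μ i * μ j := by
    intro i j
    simp only [u, inner_sub_right, inner_sub_left, inner_smul_right, real_inner_smul_left, heμ, hμμ,
      hex i μ, hee]
    ring
  have hμsum : ∑ i, μ i * μ i = 1 := by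
    have := EuclideanSpace.norm_sq_eq μ
    rw [hμ] at this
    simp only [Real.norm_eq_abs, sq_abs] at this
    simp only [← sq]
    linarith
  have hB : ∀ i j, vmfB κ μ (e i) (e j) = vmfB κ μ (u i) (u j) + μ i * μ j * vmfB κ μ μ μ := by
    intro i j
    have h1 : ∀ i, e i = u i + μ i • μ := by intro i; simp [u]
    rw [h1 i, h1 j]
    simp only [vmfB_add, vmfB_add_right, vmfB_smul, vmfB_smul_right, vmfB_cross hp0 κ μ _ (hu _),
      vmfB_symm κ μ μ (u j)]
    ring
  have htr : ∑ i, vmfB κ μ (e i) (e i) = C := by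
    unfold vmfB
    rw [← integral_finset_sum _ (fun i _ => vmfB_integrable _ _ _ _), hC]
    congr 1; ext x
    rw [← Finset.sum_mul]
    have hx : ‖(x : EuclideanSpace ℝ (Fin p))‖ = 1 := by simp
    have := EuclideanSpace.norm_sq_eq (x : EuclideanSpace ℝ (Fin p))
    rw [hx] at this
    simp only [Real.norm_eq_abs, sq_abs] at this
    simp only [hex, ← sq, ← this]
    ring
  have hutr : ∑ i, vmfB κ μ (u i) (u i) = (p - 1) * a := by
    rw [← hCB, ← htr]
    simp only [hB, Finset.sum_add_distrib, ← Finset.sum_mul, hμsum]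
    ring
  have hunorm : ∑ i, ‖u i‖ ^ 2 = p - 1 := by
    simp only [← real_inner_self_eq_norm_sq, huu, Finset.sum_sub_distrib, hμsum]
    simp
  have hp1 : (p : ℝ) - 1 ≠ 0 := by
    have : (2 : ℝ) ≤ p := by exact_mod_cast hp
    linarith
  have hQ : ∀ v, ⟪μ, v⟫ = 0 → vmfB κ μ v v = a * ‖v‖ ^ 2 := by
    intro v hv
    have h1 : ∑ i, ‖u i‖ ^ 2 * vmfB κ μ v v = ∑ i, ‖v‖ ^ 2 * vmfB κ μ (u i) (u i) :=
      Finset.sum_congr rfl fun i _ => vmfB_norm' hp0 κ μ v (u i) hv (hu i)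
    rw [← Finset.sum_mul, ← Finset.mul_sum, hunorm, hutr] at h1
    apply mul_left_cancel₀ hp1
    linear_combination h1
  have hpol : vmfB κ μ (u i) (u j) = a * ⟪u i, u j⟫ := by
    have h1 := hQ (u i + u j) (by rw [inner_add_right, hu, hu, add_zero])
    rw [norm_add_sq_real] at h1
    simp only [vmfB_add, vmfB_add_right] at h1
    rw [hQ _ (hu i), hQ _ (hu j), vmfB_symm κ μ (u j) (u i)] at h1
    linarith
  change vmfB κ μ (e i) (e j) = _
  rw [hB, hpol, huu]
  linear_combination (-(μ i * μ j)) * hCB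

end helpers

/-- Variance matrix of the von Mises–Fisher distribution:
`Variance(x) = (r_ν(κ)/κ)·I_p + (1 − (p/κ)·r_ν(κ) − r_ν(κ)²)·μμ'`. -/
theorem vmf_variance (p : ℕ) (hp : 2 ≤ p) (κ : ℝ) (hκ : 0 < κ)
    (μ : EuclideanSpace ℝ (Fin p)) (hμ : ‖μ‖ = 1) :
    (Matrix.of fun i j : Fin p =>
        (∫ x : Metric.sphere (0 : EuclideanSpace ℝ (Fin p)) 1,
            (x : EuclideanSpace ℝ (Fin p)) i * (x : EuclideanSpace ℝ (Fin p)) j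
              * vmf p κ μ (x : EuclideanSpace ℝ (Fin p)) ∂(sphereMeasure p))
          - (besselRatio (nuOf p) κ * μ i) * (besselRatio (nuOf p) κ * μ j))
      = (besselRatio (nuOf p) κ / κ) • (1 : Matrix (Fin p) (Fin p) ℝ)
        + (1 - ((p : ℝ) / κ) * besselRatio (nuOf p) κ - besselRatio (nuOf p) κ ^ 2)
            • Matrix.of (fun i j : Fin p => μ i * μ j) := by
  have hp0 : 0 < p := by omega
  have hpR : (0 : ℝ) < p := by exact_mod_cast hp0
  set ν := nuOf p with hν
  have hν1 : ν + 1 = p / 2 := by rw [hν, nuOf]; ring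
  have hsq : √π ^ p = π ^ (ν + 1) := by
    rw [hν1, Real.sqrt_eq_rpow, ← Real.rpow_natCast, ← Real.rpow_mul Real.pi_pos.le]
    congr 1; ring
  set S0 := ∑' k : ℕ, (κ / 2) ^ (2 * k) / (Nat.factorial k * Real.Gamma (ν + k + 1)) with hS0
  set S1 := ∑' k : ℕ, (κ / 2) ^ (2 * k) / (Nat.factorial k * Real.Gamma (ν + 1 + k + 1)) with hS1
  have e0 : ∀ k : ℕ, ν + k + 1 = k + p / 2 := by intro k; linarith
  have e1 : ∀ k : ℕ, ν + 1 + k + 1 = k + p / 2 + 1 := by intro k; linarith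
  have hC := (vmfaux_C hp0 κ μ hμ).tsum_eq
  have hCs := (vmfaux_C hp0 κ μ hμ).summable
  have hD := (vmfaux_D hp0 κ μ hμ).tsum_eq
  rw [tsum_mul_left] at hC hD
  have hpi : 0 < √π ^ p := by positivity
  have hS0' : 0 < S0 := by
    have hs : Summable (fun k : ℕ => (κ / 2) ^ (2 * k) / (Nat.factorial k * Real.Gamma (ν + k + 1))) := by
      simp only [e0]
      exact (summable_mul_left_iff (by positivity)).1 hCs
    have hpos : ∀ k : ℕ, 0 < (κ / 2) ^ (2 * k) / (Nat.factorial k * Real.Gamma (ν + k + 1)) := by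
      intro k
      have : 0 < Real.Gamma (ν + k + 1) := Real.Gamma_pos_of_pos (by rw [e0]; positivity)
      positivity
    exact hs.tsum_pos (fun k => (hpos k).le) 0 (hpos 0)
  simp only [← e0] at hC
  simp only [← e1] at hD
  rw [← hS0] at hC
  rw [← hS1] at hD
  have hpow : 0 < (κ / 2) ^ ν := Real.rpow_pos_of_pos (by positivity) _
  have hr : besselRatio ν κ = (κ / 2) * S1 / S0 := by
    unfold besselRatio besselI
    rw [← hS0, ← hS1, Real.rpow_add_one (by positivity)]
    field_simp
  have hCv : vmfC ν κ = 2 * √π ^ p * S0 := by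
    unfold vmfC besselI
    rw [← hS0, hsq, Real.mul_rpow (by norm_num) Real.pi_pos.le, Real.div_rpow hκ.le (by norm_num),
      Real.rpow_add_one (by norm_num) ν]
    have h1 : 0 < κ ^ ν := Real.rpow_pos_of_pos hκ _
    have h2 : (0 : ℝ) < 2 ^ ν := Real.rpow_pos_of_pos (by norm_num) _
    field_simp
  have hmain := vmfB_main hp κ (√π ^ p * S1) μ hμ (by rw [← hD]; ring)
  ext i j
  have hint : (∫ x : Metric.sphere (0 : EuclideanSpace ℝ (Fin p)) 1,
      (x : EuclideanSpace ℝ (Fin p)) i * (x : EuclideanSpace ℝ (Fin p)) j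
        * vmf p κ μ (x : EuclideanSpace ℝ (Fin p)) ∂(sphereMeasure p)) =
      vmfB κ μ (EuclideanSpace.single i 1) (EuclideanSpace.single j 1) / vmfC ν κ := by
    unfold vmfB
    rw [← integral_div]
    congr 1; ext x
    simp only [vmf, EuclideanSpace.inner_single_left, ← hν]
    simp
    ring
  simp only [Matrix.of_apply, Matrix.add_apply, Matrix.smul_apply, smul_eq_mul, Matrix.one_apply]
  rw [hint, hmain i j, ← hC, hCv, hr]
  generalize (if i = j then (1 : ℝ) else 0) = d
  generalize √π ^ p = P at *
  field_simp
  ring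
end

section
/- Let y and z be von Mises–Fisher random vectors on S_p with parameters (κ_y, μ_y) and (κ_z, μ_z), let α ∈ (0,1)∪(1,∞), and set κ_α = ‖ακ_y μ_y + (1−α)κ_z μ_z‖₂. If κ_α > 0, then the Rényi divergence of order α of y from z equals d_α(y,z) = (ν/(α−1))·ln(κ_y^α κ_z^{1−α}/κ_α) + (α/(α−1))·ln(I_ν(κ_α)/I_ν(κ_y)) − ln(I_ν(κ_α)/I_ν(κ_z)). -/
open MeasureTheory Real
open scoped RealInnerProductSpace

/-- The Rényi divergence of order `α` of `f_p(·;κ_y,μ_y)` from `f_p(·;κ_z,μ_z)`. -/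
noncomputable def renyiDiv (p : ℕ) (α κy κz : ℝ) (μy μz : EuclideanSpace ℝ (Fin p)) : ℝ :=
  (1 / (α - 1)) * Real.log (∫ x : Metric.sphere (0 : EuclideanSpace ℝ (Fin p)) 1,
      vmf p κy μy (x : EuclideanSpace ℝ (Fin p)) ^ α
        * vmf p κz μz (x : EuclideanSpace ℝ (Fin p)) ^ (1 - α) ∂(sphereMeasure p))


lemma gamma_half_aux (k : ℕ) :
    Real.Gamma (k + 1 / 2) * (4 ^ k * (Nat.factorial k : ℝ))
      = (Nat.factorial (2 * k) : ℝ) * √Real.pi := by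
  induction k with
  | zero => simp [-one_div, Real.Gamma_one_half_eq]
  | succ k ih =>
    have h : ((k + 1 : ℕ) : ℝ) + 1 / 2 = (k + 1 / 2) + 1 := by push_cast; ring
    rw [h, Real.Gamma_add_one (by positivity), show 2 * (k + 1) = (2 * k + 1) + 1 by ring,
      Nat.factorial_succ, Nat.factorial_succ, Nat.factorial_succ]
    push_cast
    linear_combination ((k + 1 / 2) * 4 * (k + 1) : ℝ) * ih

lemma integral_Ioi_pow_gauss (m : ℕ) :
    ∫ r in Set.Ioi (0 : ℝ), r ^ m * Real.exp (-r ^ 2) = Real.Gamma ((m + 1) / 2) / 2 := by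
  have h := integral_rpow_mul_exp_neg_rpow (p := 2) (q := m) (by norm_num)
    (by have : (0 : ℝ) ≤ m := m.cast_nonneg
        linarith)
  simp only [Real.rpow_natCast, Real.rpow_two] at h
  rw [h]; ring

lemma integral_pow_gauss_odd (k : ℕ) :
    ∫ r : ℝ, r ^ (2 * k + 1) * Real.exp (-r ^ 2) = 0 := by
  have h := integral_neg_eq_self (fun r : ℝ => r ^ (2 * k + 1) * Real.exp (-r ^ 2)) volume
  have h2 : (fun r : ℝ => (-r) ^ (2 * k + 1) * Real.exp (-(-r) ^ 2))
      = fun r : ℝ => -(r ^ (2 * k + 1) * Real.exp (-r ^ 2)) := by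
    funext r
    rw [Odd.neg_pow ⟨k, rfl⟩, neg_sq]; ring
  rw [h2, integral_neg] at h
  linarith

lemma integral_pow_gauss_even (k : ℕ) :
    ∫ r : ℝ, r ^ (2 * k) * Real.exp (-r ^ 2) = Real.Gamma (k + 1 / 2) := by
  have h := integral_comp_abs (f := fun r : ℝ => r ^ (2 * k) * Real.exp (-r ^ 2))
  simp only [sq_abs, Even.pow_abs (even_two_mul k)] at h
  rw [h, integral_Ioi_pow_gauss]
  push_cast
  rw [show ((2 * (k : ℝ) + 1) / 2) = k + 1 / 2 by ring]; ring

lemma integral_gauss_one : ∫ r : ℝ, Real.exp (-r ^ 2) = √Real.pi := by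
  simpa using integral_gaussian 1

/-- polar coordinates for the Gaussian moments -/
lemma gauss_polar (p : ℕ) (hp : 2 ≤ p) (n : ℕ) (w : EuclideanSpace ℝ (Fin p)) :
    ∫ x : EuclideanSpace ℝ (Fin p), ⟪w, x⟫ ^ n * Real.exp (-‖x‖ ^ 2)
      = (∫ x : Metric.sphere (0 : EuclideanSpace ℝ (Fin p)) 1,
          ⟪w, (x : EuclideanSpace ℝ (Fin p))⟫ ^ n ∂(sphereMeasure p))
        * (Real.Gamma ((n + p) / 2) / 2) := by
  have hd : Module.finrank ℝ (EuclideanSpace ℝ (Fin p)) = p := by simp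
  calc ∫ x : EuclideanSpace ℝ (Fin p), ⟪w, x⟫ ^ n * Real.exp (-‖x‖ ^ 2)
      = ∫ x : ({(0 : EuclideanSpace ℝ (Fin p))}ᶜ : Set (EuclideanSpace ℝ (Fin p))), ⟪w, x.1⟫ ^ n * Real.exp (-‖x.1‖ ^ 2)
          ∂((volume : Measure (EuclideanSpace ℝ (Fin p))).comap (↑)) := by
        have : Nontrivial (EuclideanSpace ℝ (Fin p)) := by
          apply Module.nontrivial_of_finrank_pos (R := ℝ); omega
        rw [integral_subtype_comap (measurableSet_singleton _).compl
          fun x : EuclideanSpace ℝ (Fin p) ↦ ⟪w, x⟫ ^ n * Real.exp (-‖x‖ ^ 2), restrict_compl_singleton]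
    _ = ∫ z : Metric.sphere (0 : EuclideanSpace ℝ (Fin p)) 1 × Set.Ioi (0 : ℝ),
          ⟪w, (z.1 : EuclideanSpace ℝ (Fin p))⟫ ^ n * ((z.2 : ℝ) ^ n * Real.exp (-(z.2 : ℝ) ^ 2))
          ∂(volume : Measure (EuclideanSpace ℝ (Fin p))).toSphere.prod (.volumeIoiPow (Module.finrank ℝ (EuclideanSpace ℝ (Fin p)) - 1)) := by
        rw [← (volume : Measure (EuclideanSpace ℝ (Fin p))).measurePreserving_homeomorphUnitSphereProd.integral_comp
          (Homeomorph.measurableEmbedding _)]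
        refine integral_congr_ae (.of_forall fun x => ?_)
        have hx : ‖x.1‖ ≠ 0 := norm_ne_zero_iff.2 x.2
        simp only [homeomorphUnitSphereProd_apply_fst_coe, homeomorphUnitSphereProd_apply_snd_coe,
          inner_smul_right, mul_pow, inv_pow]
        field_simp
    _ = (∫ x : Metric.sphere (0 : EuclideanSpace ℝ (Fin p)) 1, ⟪w, (x : EuclideanSpace ℝ (Fin p))⟫ ^ n ∂(volume : Measure (EuclideanSpace ℝ (Fin p))).toSphere)
        * ∫ r : Set.Ioi (0 : ℝ), ((r : ℝ) ^ n * Real.exp (-(r : ℝ) ^ 2))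
          ∂(.volumeIoiPow (Module.finrank ℝ (EuclideanSpace ℝ (Fin p)) - 1)) :=
        integral_prod_mul (fun x : Metric.sphere (0 : EuclideanSpace ℝ (Fin p)) 1 => ⟪w, (x : EuclideanSpace ℝ (Fin p))⟫ ^ n)
          (fun r : Set.Ioi (0 : ℝ) => ((r : ℝ) ^ n * Real.exp (-(r : ℝ) ^ 2)))
    _ = _ := by
      congr 1
      simp only [Measure.volumeIoiPow, ENNReal.ofReal]
      rw [integral_withDensity_eq_integral_smul,
        integral_subtype_comap measurableSet_Ioi fun a : ℝ ↦
          Real.toNNReal (a ^ (Module.finrank ℝ (EuclideanSpace ℝ (Fin p)) - 1)) • (a ^ n * Real.exp (-a ^ 2)),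
        setIntegral_congr_fun (g := fun a : ℝ => a ^ (n + p - 1) * Real.exp (-a ^ 2))
          measurableSet_Ioi fun x hx ↦ ?_, integral_Ioi_pow_gauss]
      · congr 3
        rw [Nat.cast_sub (by omega)]; push_cast; ring
      · have hx' : (0 : ℝ) ≤ x := le_of_lt hx
        simp only [NNReal.smul_def, Real.coe_toNNReal _ (pow_nonneg hx' _), smul_eq_mul]
        rw [← mul_assoc, ← pow_add, hd]
        congr 2; omega
      · exact (measurable_subtype_coe.pow_const _).real_toNNReal

lemma gauss_cart (p : ℕ) (hp : 2 ≤ p) (n : ℕ) (w : EuclideanSpace ℝ (Fin p)) (hw : w ≠ 0) :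
    ∫ x : EuclideanSpace ℝ (Fin p), ⟪w, x⟫ ^ n * Real.exp (-‖x‖ ^ 2)
      = ‖w‖ ^ n * (∫ r : ℝ, r ^ n * Real.exp (-r ^ 2)) * √Real.pi ^ (p - 1) := by
  have hw0 : ‖w‖ ≠ 0 := norm_ne_zero_iff.2 hw
  let i0 : Fin p := ⟨0, by omega⟩
  obtain ⟨b, hb⟩ := Orthonormal.exists_orthonormalBasis_extension_of_card_eq (𝕜 := ℝ)
    (E := EuclideanSpace ℝ (Fin p)) (ι := Fin p) (by simp)
    (v := fun _ => ‖w‖⁻¹ • w) (s := {i0}) (by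
      constructor
      · intro i; simp [norm_smul, hw0]
      · intro i j hij; exact absurd (Subsingleton.elim i j) hij)
  have hb0 : w = ‖w‖ • b i0 := by
    rw [hb i0 rfl, smul_smul, mul_inv_cancel₀ hw0, one_smul]
  have h1 : ∀ x : EuclideanSpace ℝ (Fin p), ⟪w, b.repr.symm x⟫ = ‖w‖ * x i0 := by
    intro x
    conv_lhs => rw [hb0]
    rw [inner_smul_left, ← b.repr_apply_apply]; simp
  rw [← b.measurePreserving_repr_symm.integral_comp
    b.repr.symm.toHomeomorph.measurableEmbedding]
  simp only [h1, LinearIsometryEquiv.norm_map]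
  rw [← (PiLp.volume_preserving_toLp (Fin p)).integral_comp
    (MeasurableEquiv.toLp 2 (Fin p → ℝ)).measurableEmbedding]
  have h2 : ∀ x : Fin p → ℝ, (‖w‖ * (WithLp.toLp 2 x : EuclideanSpace ℝ (Fin p)) i0) ^ n
      * Real.exp (-‖(WithLp.toLp 2 x : EuclideanSpace ℝ (Fin p))‖ ^ 2)
      = ‖w‖ ^ n * ∏ i, ((if i = i0 then (x i) ^ n else 1) * Real.exp (-(x i) ^ 2)) := by
    intro x
    rw [EuclideanSpace.real_norm_sq_eq, Finset.prod_mul_distrib, ← Real.exp_sum,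
      Finset.prod_ite_eq' , ← Finset.sum_neg_distrib, mul_pow]
    simp [mul_assoc]
  rw [integral_congr_ae (.of_forall h2), integral_const_mul, integral_fintype_prod_volume_eq_prod
    (f := fun i (t : ℝ) => (if i = i0 then t ^ n else 1) * Real.exp (-t ^ 2)),
    ← Finset.mul_prod_erase _ _ (Finset.mem_univ i0), mul_assoc]
  congr 2
  · rw [Finset.prod_congr rfl (g := fun _ => √Real.pi)]
    · simp
    · intro i hi
      simp [Finset.ne_of_mem_erase hi, integral_gauss_one]

lemma sphere_moment_odd (p : ℕ) (hp : 2 ≤ p) (k : ℕ) (w : EuclideanSpace ℝ (Fin p))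
    (hw : w ≠ 0) :
    ∫ x : Metric.sphere (0 : EuclideanSpace ℝ (Fin p)) 1,
          ⟪w, (x : EuclideanSpace ℝ (Fin p))⟫ ^ (2 * k + 1) ∂(sphereMeasure p) = 0 := by
  have h := gauss_polar p hp (2 * k + 1) w
  rw [gauss_cart p hp _ w hw, integral_pow_gauss_odd, mul_zero, zero_mul] at h
  have hp' : (0 : ℝ) < p := by exact_mod_cast (by omega : 0 < p)
  have hG : 0 < Real.Gamma ((((2 * k + 1 : ℕ) : ℝ) + p) / 2) :=
    Real.Gamma_pos_of_pos (by positivity)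
  rcases mul_eq_zero.1 h.symm with h | h
  · exact h
  · linarith

lemma sphere_moment_even (p : ℕ) (hp : 2 ≤ p) (k : ℕ) (w : EuclideanSpace ℝ (Fin p))
    (hw : w ≠ 0) :
    (∫ x : Metric.sphere (0 : EuclideanSpace ℝ (Fin p)) 1,
          ⟪w, (x : EuclideanSpace ℝ (Fin p))⟫ ^ (2 * k) ∂(sphereMeasure p))
        / (Nat.factorial (2 * k) : ℝ)
      = 2 * Real.pi ^ (nuOf p + 1) *
        ((‖w‖ / 2) ^ (2 * k) / (Nat.factorial k * Real.Gamma (nuOf p + k + 1))) := by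
  have h := gauss_polar p hp (2 * k) w
  rw [gauss_cart p hp _ w hw, integral_pow_gauss_even] at h
  have hp' : (0 : ℝ) < p := by exact_mod_cast (by omega : 0 < p)
  have he : (((2 * k : ℕ) : ℝ) + p) / 2 = nuOf p + k + 1 := by
    rw [nuOf]; push_cast; ring
  have hG : 0 < Real.Gamma (nuOf p + k + 1) :=
    Real.Gamma_pos_of_pos (by rw [← he]; positivity)
  rw [he] at h
  have hpi : Real.pi ^ (nuOf p + 1) = √Real.pi ^ (p - 1) * √Real.pi := by
    rw [← pow_succ, Nat.sub_add_cancel (by omega), Real.sqrt_eq_rpow, ← Real.rpow_natCast,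
      ← Real.rpow_mul Real.pi_pos.le, nuOf]
    congr 1; ring
  have hg := gamma_half_aux k
  rw [hpi]
  have h4 : (‖w‖ / 2) ^ (2 * k) = ‖w‖ ^ (2 * k) / 4 ^ k := by
    rw [div_pow, pow_mul 2]; norm_num
  rw [h4]
  have hf : (Nat.factorial k : ℝ) ≠ 0 := by positivity
  have hf2 : (Nat.factorial (2 * k) : ℝ) ≠ 0 := by positivity
  have hg' : Real.Gamma (k + 1 / 2)
      = (Nat.factorial (2 * k) : ℝ) * √Real.pi / (4 ^ k * (Nat.factorial k : ℝ)) := by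
    rw [eq_div_iff (by positivity), hg]
  rw [hg'] at h
  rw [div_eq_iff hf2]
  have h5 := eq_div_of_mul_eq (by positivity) h.symm
  rw [h5]
  field_simp

lemma sphere_exp_hasSum (p : ℕ) (hp : 2 ≤ p) (w : EuclideanSpace ℝ (Fin p)) (hw : w ≠ 0) :
    HasSum (fun k : ℕ => 2 * Real.pi ^ (nuOf p + 1) *
        ((‖w‖ / 2) ^ (2 * k) / (Nat.factorial k * Real.Gamma (nuOf p + k + 1))))
      (∫ x : Metric.sphere (0 : EuclideanSpace ℝ (Fin p)) 1,
          Real.exp ⟪w, (x : EuclideanSpace ℝ (Fin p))⟫ ∂(sphereMeasure p)) := by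
  have : IsFiniteMeasure (sphereMeasure p) := by unfold sphereMeasure; infer_instance
  have h : HasSum (fun n : ℕ => ∫ x : Metric.sphere (0 : EuclideanSpace ℝ (Fin p)) 1,
          ⟪w, (x : EuclideanSpace ℝ (Fin p))⟫ ^ n / (Nat.factorial n : ℝ) ∂(sphereMeasure p))
      (∫ x : Metric.sphere (0 : EuclideanSpace ℝ (Fin p)) 1,
          Real.exp ⟪w, (x : EuclideanSpace ℝ (Fin p))⟫ ∂(sphereMeasure p)) := by
    refine hasSum_integral_of_dominated_convergence
      (fun n _ => ‖w‖ ^ n / (Nat.factorial n : ℝ)) ?_ ?_ ?_ ?_ ?_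
    · intro n
      exact (by fun_prop : Continuous fun x : Metric.sphere (0 : EuclideanSpace ℝ (Fin p)) 1 =>
        ⟪w, (x : EuclideanSpace ℝ (Fin p))⟫ ^ n / (Nat.factorial n : ℝ)).aestronglyMeasurable
    · intro n
      refine .of_forall fun x => ?_
      rw [norm_div, norm_pow, Real.norm_natCast]
      gcongr
      have := norm_inner_le_norm (𝕜 := ℝ) w (x : EuclideanSpace ℝ (Fin p))
      simpa using this
    · exact .of_forall fun _ => Real.summable_pow_div_factorial _
    · exact integrable_const _
    · refine .of_forall fun x => ?_
      rw [Real.exp_eq_exp_ℝ]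
      exact NormedSpace.expSeries_div_hasSum_exp _
  have hinj : Function.Injective (fun k : ℕ => 2 * k) := fun a b hab => by
    simpa using hab
  rw [← hinj.hasSum_iff] at h
  · convert h using 2 with k
    simp only [Function.comp]
    rw [integral_div, sphere_moment_even p hp k w hw]
  · intro n hn
    rcases Nat.even_or_odd' n with ⟨k, rfl | rfl⟩
    · exact absurd ⟨k, rfl⟩ hn
    · rw [integral_div, sphere_moment_odd p hp k w hw, zero_div]

lemma sphere_exp_eq (p : ℕ) (hp : 2 ≤ p) (w : EuclideanSpace ℝ (Fin p)) (hw : w ≠ 0) :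
    ∫ x : Metric.sphere (0 : EuclideanSpace ℝ (Fin p)) 1,
          Real.exp ⟪w, (x : EuclideanSpace ℝ (Fin p))⟫ ∂(sphereMeasure p)
      = vmfC (nuOf p) ‖w‖ := by
  have hw0 : 0 < ‖w‖ := norm_pos_iff.2 hw
  rw [← (sphere_exp_hasSum p hp w hw).tsum_eq, tsum_mul_left, vmfC, besselI,
    Real.mul_rpow (by norm_num) Real.pi_pos.le, Real.div_rpow hw0.le (by norm_num),
    Real.rpow_add_one (by norm_num : (2 : ℝ) ≠ 0)]
  have h1 : (2 : ℝ) ^ nuOf p ≠ 0 := by positivity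
  have h2 : ‖w‖ ^ nuOf p ≠ 0 := by positivity
  field_simp

lemma bessel_pos (p : ℕ) (hp : 2 ≤ p) (κ : ℝ) (hκ : 0 < κ) : 0 < besselI (nuOf p) κ := by
  let w : EuclideanSpace ℝ (Fin p) := EuclideanSpace.single ⟨0, by omega⟩ κ
  have hw : ‖w‖ = κ := by simp [w, abs_of_pos hκ]
  have hw0 : w ≠ 0 := norm_pos_iff.1 (by rw [hw]; exact hκ)
  have hs := (sphere_exp_hasSum p hp w hw0).summable
  rw [hw] at hs
  have hs' := (summable_mul_left_iff (by positivity)).1 hs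
  have hp' : (2 : ℝ) ≤ p := by exact_mod_cast hp
  have hG : ∀ k : ℕ, 0 < Real.Gamma (nuOf p + k + 1) := fun k =>
    Real.Gamma_pos_of_pos (by
      have : (0 : ℝ) ≤ k := k.cast_nonneg
      rw [nuOf]; linarith)
  unfold besselI
  refine mul_pos (by positivity) (hs'.tsum_pos (fun k => ?_) 0 ?_)
  · have := hG k
    positivity
  · have := hG 0
    positivity

/-- Rényi divergence between two von Mises–Fisher distributions when `κ_α > 0`. -/
theorem renyi_divergence_vmf (p : ℕ) (hp : 2 ≤ p) (α : ℝ) (hα : 0 < α) (hα1 : α ≠ 1)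
    (κy κz : ℝ) (hκy : 0 < κy) (hκz : 0 < κz)
    (μy μz : EuclideanSpace ℝ (Fin p)) (hμy : ‖μy‖ = 1) (hμz : ‖μz‖ = 1)
    (κα : ℝ) (hκα : κα = ‖(α * κy) • μy + ((1 - α) * κz) • μz‖) (hκαpos : 0 < κα) :
    renyiDiv p α κy κz μy μz
      = nuOf p / (α - 1) * Real.log (κy ^ α * κz ^ (1 - α) / κα)
        + α / (α - 1) * Real.log (besselI (nuOf p) κα / besselI (nuOf p) κy)
        - Real.log (besselI (nuOf p) κα / besselI (nuOf p) κz) := by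
  have hν : ∀ κ : ℝ, 0 < κ → 0 < vmfC (nuOf p) κ ∧
      Real.log (vmfC (nuOf p) κ) = (nuOf p + 1) * Real.log (2 * Real.pi)
        + Real.log (besselI (nuOf p) κ) - nuOf p * Real.log κ := by
    intro κ hκ
    have hB := bessel_pos p hp κ hκ
    have h2pi : 0 < 2 * Real.pi := by positivity
    unfold vmfC
    refine ⟨by positivity, ?_⟩
    rw [Real.log_div (by positivity) (by positivity), Real.log_mul (by positivity) hB.ne',
      Real.log_rpow h2pi, Real.log_rpow hκ]
  obtain ⟨hCy, hLy⟩ := hν κy hκy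
  obtain ⟨hCz, hLz⟩ := hν κz hκz
  obtain ⟨hCa, hLa⟩ := hν κα hκαpos
  have hBy := bessel_pos p hp κy hκy
  have hBz := bessel_pos p hp κz hκz
  have hBa := bessel_pos p hp κα hκαpos
  have hα2 : α - 1 ≠ 0 := sub_ne_zero.2 hα1
  have hw : (α * κy) • μy + ((1 - α) * κz) • μz ≠ 0 :=
    norm_pos_iff.1 (by rw [← hκα]; exact hκαpos)
  have key : ∫ x : Metric.sphere (0 : EuclideanSpace ℝ (Fin p)) 1,
      vmf p κy μy (x : EuclideanSpace ℝ (Fin p)) ^ α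
        * vmf p κz μz (x : EuclideanSpace ℝ (Fin p)) ^ (1 - α) ∂(sphereMeasure p)
      = vmfC (nuOf p) κα / (vmfC (nuOf p) κy ^ α * vmfC (nuOf p) κz ^ (1 - α)) := by
    rw [hκα, ← sphere_exp_eq p hp _ hw, ← integral_div]
    refine integral_congr_ae (.of_forall fun x => ?_)
    simp only [vmf]
    rw [Real.div_rpow (Real.exp_pos _).le hCy.le, Real.div_rpow (Real.exp_pos _).le hCz.le,
      ← Real.exp_mul, ← Real.exp_mul, div_mul_div_comm, ← Real.exp_add]
    congr 2
    rw [inner_add_left, inner_smul_left, inner_smul_left]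
    simp only [conj_trivial]
    ring
  unfold renyiDiv
  rw [key, Real.log_div hCa.ne' (by positivity), Real.log_mul (by positivity) (by positivity),
    Real.log_rpow hCy, Real.log_rpow hCz, hLy, hLz, hLa,
    Real.log_div (by positivity) hκαpos.ne',
    Real.log_mul (Real.rpow_pos_of_pos hκy α).ne' (Real.rpow_pos_of_pos hκz (1 - α)).ne',
    Real.log_rpow hκy, Real.log_rpow hκz, Real.log_div hBa.ne' hBy.ne',
    Real.log_div hBa.ne' hBz.ne']
  field_simp
  ring
end

section
/- Fix α ∈ (1,∞), κ_z > 0 and unit vectors μ_y, μ_z ∈ ℝ^p, and for κ_y > 0 let d_α(κ_y) denote the Rényi divergence of order α of the von Mises–Fisher distribution with parameters (κ_y, μ_y) from the one with parameters (κ_z, μ_z). Then d_α(κ_y) = O(ln κ_y) as κ_y → ∞: there exist constants C > 0 and K ≥ max(κ_z, e) such that |d_α(κ_y)| ≤ C·ln(κ_y) for all κ_y ≥ K. -/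
open MeasureTheory Real
open scoped RealInnerProductSpace

lemma gam_lower (ν : ℝ) (hν : 0 ≤ ν) (k : ℕ) :
    Real.Gamma (ν + 1) * (Nat.factorial k : ℝ) ≤ Real.Gamma (ν + k + 1) := by
  induction k with
  | zero => simp
  | succ k ih =>
    have h : ν + (k + 1 : ℕ) + 1 = (ν + k + 1) + 1 := by push_cast; ring
    have hk : (0 : ℝ) ≤ k := Nat.cast_nonneg k
    rw [h, Real.Gamma_add_one (s := ν + k + 1) (by positivity), Nat.factorial_succ]
    push_cast
    have hg : 0 < Real.Gamma (ν + 1) := Real.Gamma_pos_of_pos (by linarith)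
    calc Real.Gamma (ν + 1) * (((k : ℝ) + 1) * (Nat.factorial k : ℝ))
        = ((k : ℝ) + 1) * (Real.Gamma (ν + 1) * (Nat.factorial k : ℝ)) := by ring
      _ ≤ (ν + k + 1) * Real.Gamma (ν + k + 1) := by
        apply mul_le_mul _ ih (by positivity) (by positivity)
        linarith

lemma gam_upper (ν : ℝ) (hν : 0 ≤ ν) (n : ℕ) (hn : ν ≤ n) (k : ℕ) :
    Real.Gamma (ν + k + 1) ≤ Real.Gamma (ν + 1) * (Nat.factorial (k + n) : ℝ) := by
  have hg : 0 < Real.Gamma (ν + 1) := Real.Gamma_pos_of_pos (by linarith)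
  induction k with
  | zero =>
    have : (1 : ℝ) ≤ (Nat.factorial n : ℝ) := by exact_mod_cast Nat.factorial_pos n
    simp only [Nat.cast_zero, add_zero, zero_add]
    nlinarith
  | succ k ih =>
    have h : ν + (k + 1 : ℕ) + 1 = (ν + k + 1) + 1 := by push_cast; ring
    have hk : (0 : ℝ) ≤ k := Nat.cast_nonneg k
    have h2 : k + 1 + n = (k + n) + 1 := by ring
    rw [h, Real.Gamma_add_one (by positivity), h2, Nat.factorial_succ]
    push_cast
    have hg' : 0 < Real.Gamma (ν + k + 1) := Real.Gamma_pos_of_pos (by positivity)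
    calc (ν + k + 1) * Real.Gamma (ν + k + 1)
        ≤ ((k : ℝ) + n + 1) * (Real.Gamma (ν + 1) * (Nat.factorial (k + n) : ℝ)) := by
          apply mul_le_mul _ ih hg'.le (by positivity)
          linarith
      _ = _ := by ring

lemma fact_ineq (k n : ℕ) :
    Nat.factorial k * Nat.factorial (k + n) * 4 ^ k ≤ Nat.factorial (2 * k + 1 + n) := by
  induction n with
  | zero =>
    induction k with
    | zero => simp
    | succ k ih =>
      have h : 2 * (k + 1) + 1 + 0 = (2 * k + 1 + 0) + 1 + 1 := by ring
      rw [h, Nat.factorial_succ, Nat.factorial_succ, Nat.add_zero, Nat.factorial_succ, pow_succ]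
      rw [Nat.add_zero] at ih
      calc (k + 1) * k.factorial * ((k + 1) * k.factorial) * (4 ^ k * 4)
          = (4 * (k + 1) ^ 2) * (k.factorial * k.factorial * 4 ^ k) := by ring
        _ ≤ ((2 * k + 1 + 0 + 1 + 1) * (2 * k + 1 + 0 + 1)) * Nat.factorial (2 * k + 1 + 0) := by
          apply Nat.mul_le_mul _ ih
          nlinarith
        _ = _ := by ring
  | succ n ih =>
    rw [← add_assoc, ← add_assoc, Nat.factorial_succ, Nat.factorial_succ]
    calc k.factorial * ((k + n + 1) * (k + n).factorial) * 4 ^ k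
        = (k + n + 1) * (k.factorial * (k + n).factorial * 4 ^ k) := by ring
      _ ≤ _ := Nat.mul_le_mul (by omega) ih

/-- the series term -/
noncomputable def bt (ν z : ℝ) (k : ℕ) : ℝ :=
  (z / 2) ^ (2 * k) / (Nat.factorial k * Real.Gamma (ν + k + 1))

lemma bt_nonneg (ν z : ℝ) (hν : 0 ≤ ν) (k : ℕ) : 0 ≤ bt ν z k := by
  have hg' : 0 < Real.Gamma (ν + k + 1) := Real.Gamma_pos_of_pos (by positivity)
  unfold bt
  rw [pow_mul]
  positivity

lemma bt_le (ν z : ℝ) (hν : 0 ≤ ν) (hz : 0 ≤ z) (k : ℕ) :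
    bt ν z k ≤ (Real.exp (z / 2) / Real.Gamma (ν + 1)) * ((z / 2) ^ k / (Nat.factorial k : ℝ)) := by
  have hg : 0 < Real.Gamma (ν + 1) := Real.Gamma_pos_of_pos (by linarith)
  have hf : (0 : ℝ) < (Nat.factorial k : ℝ) := by exact_mod_cast Nat.factorial_pos k
  have h1 := Real.pow_div_factorial_le_exp (z / 2) (by positivity) k
  have h2 := gam_lower ν hν k
  unfold bt
  calc (z / 2) ^ (2 * k) / (Nat.factorial k * Real.Gamma (ν + k + 1))
      ≤ (z / 2) ^ (2 * k) / (Nat.factorial k * (Real.Gamma (ν + 1) * (Nat.factorial k : ℝ))) := by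
        gcongr
    _ = ((z / 2) ^ k / (Nat.factorial k : ℝ)) / Real.Gamma (ν + 1) *
          ((z / 2) ^ k / (Nat.factorial k : ℝ)) := by
        rw [two_mul, pow_add]; field_simp
    _ ≤ _ := by gcongr

lemma exp_hasSum (x : ℝ) : HasSum (fun k : ℕ => x ^ k / (Nat.factorial k : ℝ)) (Real.exp x) := by
  rw [Real.exp_eq_exp_ℝ]
  exact NormedSpace.expSeries_div_hasSum_exp x

lemma bt_summable (ν z : ℝ) (hν : 0 ≤ ν) (hz : 0 ≤ z) : Summable (bt ν z) :=
  Summable.of_nonneg_of_le (bt_nonneg ν z hν) (bt_le ν z hν hz)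
    ((exp_hasSum (z / 2)).summable.mul_left _)

lemma bt_tsum_le (ν z : ℝ) (hν : 0 ≤ ν) (hz : 0 ≤ z) :
    ∑' k, bt ν z k ≤ (1 / Real.Gamma (ν + 1)) * Real.exp z := by
  have h := (bt_summable ν z hν hz).tsum_le_tsum (bt_le ν z hν hz)
    ((exp_hasSum (z / 2)).summable.mul_left _)
  rw [tsum_mul_left, (exp_hasSum (z / 2)).tsum_eq] at h
  refine h.trans (le_of_eq ?_)
  have : Real.exp z = Real.exp (z / 2) * Real.exp (z / 2) := by
    rw [← Real.exp_add]; ring_nf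
  rw [this]; ring

lemma bt_ge (ν z : ℝ) (hν : 0 ≤ ν) (n : ℕ) (hn : ν ≤ n) (hz : 0 ≤ z) (k : ℕ) :
    z ^ (2 * k) / (Nat.factorial (2 * k + 1 + n) : ℝ) ≤ Real.Gamma (ν + 1) * bt ν z k := by
  have hg : 0 < Real.Gamma (ν + 1) := Real.Gamma_pos_of_pos (by linarith)
  have hg' : 0 < Real.Gamma (ν + k + 1) := Real.Gamma_pos_of_pos (by positivity)
  have hf : (0 : ℝ) < (Nat.factorial k : ℝ) := by exact_mod_cast Nat.factorial_pos k
  have hf2 : (0 : ℝ) < (Nat.factorial (k + n) : ℝ) := by exact_mod_cast Nat.factorial_pos _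
  have h1 : (Nat.factorial k : ℝ) * Nat.factorial (k + n) * 4 ^ k ≤ Nat.factorial (2 * k + 1 + n) := by
    exact_mod_cast fact_ineq k n
  have h2 := gam_upper ν hν n hn k
  calc z ^ (2 * k) / (Nat.factorial (2 * k + 1 + n) : ℝ)
      ≤ z ^ (2 * k) / ((Nat.factorial k : ℝ) * Nat.factorial (k + n) * 4 ^ k) := by gcongr
    _ = Real.Gamma (ν + 1) * ((z / 2) ^ (2 * k) /
          (Nat.factorial k * (Real.Gamma (ν + 1) * (Nat.factorial (k + n) : ℝ)))) := by
        rw [div_pow, pow_mul 2 2 k]; norm_num; field_simp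
    _ ≤ _ := by unfold bt; gcongr

lemma bt_tsum_ge (ν : ℝ) (hν : 0 ≤ ν) (n : ℕ) (hn : ν ≤ n) :
    ∃ A > 0, ∀ z : ℝ, 1 ≤ z → Real.exp z ≤ A * z ^ (n + 2) * ∑' k, bt ν z k := by
  have hg : 0 < Real.Gamma (ν + 1) := Real.Gamma_pos_of_pos (by linarith)
  set G := Real.Gamma (ν + 1) with hG
  refine ⟨2 * G + (n + 1) * (Nat.factorial (n + 1) * G), by positivity, fun z hz => ?_⟩
  have hz0 : 0 ≤ z := by linarith
  set S := ∑' k, bt ν z k with hS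
  have hsum := bt_summable ν z hν hz0
  have hexp := exp_hasSum z
  set f : ℕ → ℝ := fun k => z ^ k / (Nat.factorial k : ℝ) with hf
  have hfs : Summable f := hexp.summable
  have hsplit := hfs.sum_add_tsum_nat_add (n + 1)
  rw [hexp.tsum_eq] at hsplit
  have hfs' : Summable (fun k => f (k + (n + 1))) := (summable_nat_add_iff (n + 1)).2 hfs
  have he : Summable (fun k => f (2 * k + (n + 1))) :=
    hfs'.comp_injective (i := fun k => 2 * k) (fun a b h => by simpa using h)
  have ho : Summable (fun k => f (2 * k + 1 + (n + 1))) :=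
    hfs'.comp_injective (i := fun k => 2 * k + 1) (fun a b h => by simpa using h)
  have heo := tsum_even_add_odd (f := fun k => f (k + (n + 1))) he ho
  have hbound : ∀ k, f (2 * k + (n + 1)) ≤ z ^ (n + 2) * G * bt ν z k := by
    intro k
    have h := bt_ge ν z hν n hn hz0 k
    calc f (2 * k + (n + 1)) = z ^ (n + 1) * (z ^ (2 * k) / (Nat.factorial (2 * k + 1 + n) : ℝ)) := by
          simp only [hf]
          rw [show 2 * k + (n + 1) = 2 * k + 1 + n by ring]
          rw [show z ^ (2 * k + 1 + n) = z ^ (n + 1) * z ^ (2 * k) by ring]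
          ring
      _ ≤ z ^ (n + 2) * (G * bt ν z k) := by
          have : z ^ (n + 1) ≤ z ^ (n + 2) := pow_le_pow_right₀ hz (by omega)
          gcongr
      _ = _ := by ring
  have hbound2 : ∀ k, f (2 * k + 1 + (n + 1)) ≤ z ^ (n + 2) * G * bt ν z k := by
    intro k
    have h := bt_ge ν z hν n hn hz0 k
    have hfac : (Nat.factorial (2 * k + 1 + n) : ℝ) ≤ Nat.factorial (2 * k + 1 + (n + 1)) := by
      exact_mod_cast Nat.factorial_le (by omega)
    calc f (2 * k + 1 + (n + 1)) ≤ z ^ (2 * k + 1 + (n + 1)) / (Nat.factorial (2 * k + 1 + n) : ℝ) := by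
          simp only [hf]
          gcongr
      _ = z ^ (n + 2) * (z ^ (2 * k) / (Nat.factorial (2 * k + 1 + n) : ℝ)) := by
          rw [show z ^ (2 * k + 1 + (n + 1)) = z ^ (n + 2) * z ^ (2 * k) by ring]
          ring
      _ ≤ z ^ (n + 2) * (G * bt ν z k) := by
          gcongr
      _ = _ := by ring
  have t1 := he.tsum_le_tsum hbound (hsum.mul_left _)
  have t2 := ho.tsum_le_tsum hbound2 (hsum.mul_left _)
  rw [tsum_mul_left] at t1 t2
  -- finite part
  have hfin : ∑ i ∈ Finset.range (n + 1), f i ≤ (n + 1) * z ^ (n + 2) := by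
    have : ∀ i ∈ Finset.range (n + 1), f i ≤ z ^ (n + 2) := by
      intro i hi
      have hi' := Finset.mem_range.1 hi
      have h1 : (1 : ℝ) ≤ (Nat.factorial i : ℝ) := by exact_mod_cast Nat.factorial_pos i
      calc f i ≤ z ^ i := div_le_self (by positivity) h1
        _ ≤ z ^ (n + 2) := pow_le_pow_right₀ hz (by omega)
    have := Finset.sum_le_card_nsmul _ _ _ this
    simpa using this
  have hSge : 1 ≤ (Nat.factorial (n + 1) * G) * S := by
    have h := bt_ge ν z hν n hn hz0 0
    have h' : bt ν z 0 ≤ S := hsum.le_tsum 0 (fun j _ => bt_nonneg ν z hν j)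
    have hfp : (0 : ℝ) < Nat.factorial (n + 1) := by exact_mod_cast Nat.factorial_pos _
    simp only [mul_zero, pow_zero, zero_add] at h
    rw [add_comm 1 n, div_le_iff₀ hfp] at h
    calc (1 : ℝ) ≤ G * bt ν z 0 * Nat.factorial (n + 1) := h
      _ ≤ G * S * Nat.factorial (n + 1) := by gcongr
      _ = _ := by ring
  have hlast : ((n : ℝ) + 1) * z ^ (n + 2) * 1
      ≤ (n + 1) * z ^ (n + 2) * ((Nat.factorial (n + 1) * G) * S) := by gcongr
  calc Real.exp z ≤ (n + 1) * z ^ (n + 2) * 1 + 2 * (z ^ (n + 2) * G * S) := by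
        rw [← hsplit, ← heo]; linarith
    _ ≤ _ := by linarith

lemma vmfC_eq (ν κ : ℝ) (hκ : 0 < κ) :
    vmfC ν κ = ((2 * Real.pi) ^ (ν + 1) / 2 ^ ν) * ∑' k, bt ν κ k := by
  unfold vmfC besselI bt
  rw [Real.div_rpow hκ.le (by norm_num)]
  have : 0 < κ ^ ν := Real.rpow_pos_of_pos hκ _
  field_simp

lemma vmfC_pos (ν κ : ℝ) (hν : 0 ≤ ν) (hκ : 0 < κ) : 0 < vmfC ν κ := by
  rw [vmfC_eq ν κ hκ]
  have h : 0 < bt ν κ 0 := by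
    have hg : 0 < Real.Gamma (ν + 1) := Real.Gamma_pos_of_pos (by linarith)
    simp [bt, hg]
  have := (bt_summable ν κ hν hκ.le).tsum_pos (bt_nonneg ν κ hν) 0 h
  have := Real.pi_pos
  positivity

lemma log_two_sided (F E : ℝ → ℝ) (A B : ℝ) (m : ℕ) (hA : 0 < A) (hB : 0 < B)
    (hF : ∀ z, 1 ≤ z → 0 < F z)
    (h1 : ∀ z, 1 ≤ z → Real.exp (E z) ≤ A * z ^ m * F z)
    (h2 : ∀ z, 1 ≤ z → F z ≤ B * Real.exp (E z)) :
    ∃ a ≥ 0, ∀ z, 1 ≤ z → |Real.log (F z) - E z| ≤ a * (1 + Real.log z) := by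
  refine ⟨|Real.log A| + |Real.log B| + m, by positivity, fun z hz => ?_⟩
  have hz0 : 0 < z := by linarith
  have hF' := hF z hz
  have l1 := Real.log_le_log (Real.exp_pos _) (h1 z hz)
  have l2 := Real.log_le_log hF' (h2 z hz)
  rw [Real.log_exp, Real.log_mul (by positivity) hF'.ne', Real.log_mul hA.ne' (by positivity),
    Real.log_pow] at l1
  rw [Real.log_mul hB.ne' (Real.exp_pos _).ne', Real.log_exp] at l2
  have hl : 0 ≤ Real.log z := Real.log_nonneg hz
  have := le_abs_self (Real.log A)
  have := le_abs_self (Real.log B)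
  have a1 := abs_nonneg (Real.log A)
  have a2 := abs_nonneg (Real.log B)
  have hm : (0 : ℝ) ≤ m := Nat.cast_nonneg m
  have := mul_nonneg a1 hl
  have := mul_nonneg a2 hl
  have := mul_nonneg hm hl
  rw [abs_le]
  constructor <;> nlinarith

lemma vmfC_log (ν : ℝ) (hν : 0 ≤ ν) :
    ∃ a ≥ 0, ∀ z, 1 ≤ z → |Real.log (vmfC ν z) - z| ≤ a * (1 + Real.log z) := by
  obtain ⟨n, hn⟩ := exists_nat_ge ν
  obtain ⟨A, hA, hAz⟩ := bt_tsum_ge ν hν n hn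
  have hg : 0 < Real.Gamma (ν + 1) := Real.Gamma_pos_of_pos (by linarith)
  have hc : 0 < ((2 * Real.pi) ^ (ν + 1) / 2 ^ ν) := by have := Real.pi_pos; positivity
  have hce := vmfC_eq ν
  set c := ((2 * Real.pi) ^ (ν + 1) / 2 ^ ν)
  refine log_two_sided (vmfC ν) (fun z => z) (A / c) (c * (1 / Real.Gamma (ν + 1))) (n + 2)
    (by positivity) (by positivity) (fun z hz => vmfC_pos ν z hν (by linarith)) ?_ ?_
  · intro z hz
    rw [hce z (by linarith)]
    refine (hAz z hz).trans (le_of_eq ?_)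
    field_simp
  · intro z hz
    rw [hce z (by linarith), mul_assoc]
    exact mul_le_mul_of_nonneg_left (bt_tsum_le ν z hν (by linarith)) hc.le

section cap
open scoped Pointwise
variable {p : ℕ}

lemma sphere_finite (p : ℕ) : IsFiniteMeasure (sphereMeasure p) := by
  unfold sphereMeasure; infer_instance

def capSet (μ : EuclideanSpace ℝ (Fin p)) (δ : ℝ) : Set (Metric.sphere (0 : EuclideanSpace ℝ (Fin p)) 1) :=
  {x | 1 - δ ≤ ⟪μ, (x : EuclideanSpace ℝ (Fin p))⟫}

lemma capSet_meas (μ : EuclideanSpace ℝ (Fin p)) (δ : ℝ) : MeasurableSet (capSet μ δ) := by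
  apply IsClosed.measurableSet
  unfold capSet
  exact isClosed_le continuous_const (by fun_prop)

lemma ball_sub_cap (μ : EuclideanSpace ℝ (Fin p)) (hμ : ‖μ‖ = 1) (δ : ℝ) (hδ : 0 < δ) (hδ1 : δ ≤ 1) :
    Metric.ball ((1 / 2 : ℝ) • μ) (δ / 8) ⊆
      Set.Ioo (0 : ℝ) 1 • ((↑) '' capSet μ δ : Set (EuclideanSpace ℝ (Fin p))) := by
  intro y hy
  rw [mem_ball_iff_norm] at hy
  have hn : ‖(1 / 2 : ℝ) • μ‖ = 1 / 2 := by rw [norm_smul, hμ]; norm_num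
  have h1 := norm_sub_norm_le y ((1 / 2 : ℝ) • μ)
  have h2 := norm_sub_norm_le ((1 / 2 : ℝ) • μ) y
  rw [norm_sub_rev] at h2
  rw [hn] at h1 h2
  have hy0 : 0 < ‖y‖ := by linarith
  have hin : ⟪μ, y⟫ ≥ 1 / 2 - δ / 8 := by
    have e : y = (1 / 2 : ℝ) • μ + (y - (1 / 2 : ℝ) • μ) := by abel
    have hc := abs_real_inner_le_norm μ (y - (1 / 2 : ℝ) • μ)
    rw [hμ, one_mul] at hc
    have := (abs_le.1 hc).1
    rw [e, inner_add_right, inner_smul_right, real_inner_self_eq_norm_sq, hμ]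
    linarith
  refine Set.mem_smul.2 ⟨‖y‖, ⟨hy0, by linarith⟩, ‖y‖⁻¹ • y, ?_, ?_⟩
  · refine ⟨⟨‖y‖⁻¹ • y, ?_⟩, ?_, rfl⟩
    · rw [mem_sphere_zero_iff_norm, norm_smul, norm_inv, norm_norm, inv_mul_cancel₀ hy0.ne']
    · simp only [capSet, Set.mem_setOf_eq]
      rw [inner_smul_right, inv_mul_eq_div, le_div_iff₀ hy0]
      nlinarith
  · rw [smul_smul, mul_inv_cancel₀ hy0.ne', one_smul]

lemma cap_lower (hp : 2 ≤ p) (μ : EuclideanSpace ℝ (Fin p)) (hμ : ‖μ‖ = 1) :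
    ∃ c > 0, ∀ δ : ℝ, 0 < δ → δ ≤ 1 → c * δ ^ p ≤ (sphereMeasure p).real (capSet μ δ) := by
  have hV : 0 < (volume : Measure (EuclideanSpace ℝ (Fin p))).real (Metric.ball 0 1) := by
    rw [measureReal_def]
    exact ENNReal.toReal_pos (Metric.measure_ball_pos _ _ one_pos).ne' measure_ball_lt_top.ne
  haveI := sphere_finite p
  set V := (volume : Measure (EuclideanSpace ℝ (Fin p))).real (Metric.ball 0 1) with hVd
  have hp0 : (0 : ℝ) < p := by exact_mod_cast (by omega : 0 < p)
  refine ⟨p * (1 / 8) ^ p * V, by positivity, fun δ hδ hδ1 => ?_⟩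
  have h1 : (sphereMeasure p) (capSet μ δ)
      = p * volume (Set.Ioo (0 : ℝ) 1 • ((↑) '' capSet μ δ : Set (EuclideanSpace ℝ (Fin p)))) := by
    unfold sphereMeasure
    rw [Measure.toSphere_apply' _ (capSet_meas μ δ)]
    simp
  have h2 : (p : ENNReal) * volume (Metric.ball ((1 / 2 : ℝ) • μ) (δ / 8)) ≤
      (sphereMeasure p) (capSet μ δ) := by
    rw [h1]
    gcongr
    exact ball_sub_cap μ hμ δ hδ hδ1
  rw [Measure.addHaar_ball_of_pos _ _ (by positivity : 0 < δ / 8)] at h2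
  have h3 := ENNReal.toReal_mono (measure_ne_top _ _) h2
  rw [ENNReal.toReal_mul, ENNReal.toReal_mul, ENNReal.toReal_ofReal (by positivity)] at h3
  simp only [finrank_euclideanSpace, Fintype.card_fin, ENNReal.toReal_natCast] at h3
  rw [measureReal_def]
  refine le_trans (le_of_eq ?_) h3
  rw [hVd, measureReal_def, div_pow, div_pow, one_pow]
  ring

/-- the numerator integral -/
noncomputable def numI (p : ℕ) (α κy κz : ℝ) (μy μz : EuclideanSpace ℝ (Fin p)) : ℝ :=
  ∫ x : Metric.sphere (0 : EuclideanSpace ℝ (Fin p)) 1,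
    Real.exp (α * (κy * ⟪μy, (x : EuclideanSpace ℝ (Fin p))⟫) + (1 - α) *
      (κz * ⟪μz, (x : EuclideanSpace ℝ (Fin p))⟫)) ∂(sphereMeasure p)

lemma numI_log (hp : 2 ≤ p) (α : ℝ) (hα : 1 < α) (κz : ℝ) (hκz : 0 < κz)
    (μy μz : EuclideanSpace ℝ (Fin p)) (hμy : ‖μy‖ = 1) (hμz : ‖μz‖ = 1) :
    ∃ b ≥ 0, ∀ z, 1 ≤ z →
      0 < numI p α z κz μy μz ∧
      |Real.log (numI p α z κz μy μz) - α * z| ≤ b * (1 + Real.log z) := by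
  haveI := sphere_finite p
  obtain ⟨c, hc, hcap⟩ := cap_lower hp μy hμy
  set D := (α - 1) * κz with hD
  have hD0 : 0 ≤ D := by have : 0 < α - 1 := by linarith
                         positivity
  have ipb : ∀ (μ : EuclideanSpace ℝ (Fin p)), ‖μ‖ = 1 →
      ∀ x : Metric.sphere (0 : EuclideanSpace ℝ (Fin p)) 1,
      |⟪μ, (x : EuclideanSpace ℝ (Fin p))⟫| ≤ 1 := by
    intro μ hμ x
    have := abs_real_inner_le_norm μ (x : EuclideanSpace ℝ (Fin p))
    rwa [hμ, norm_eq_of_mem_sphere x, one_mul] at this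
  have hDz : ∀ x : Metric.sphere (0 : EuclideanSpace ℝ (Fin p)) 1,
      |(1 - α) * (κz * ⟪μz, (x : EuclideanSpace ℝ (Fin p))⟫)| ≤ D := by
    intro x
    have h := ipb μz hμz x
    rw [abs_mul, abs_mul, abs_of_pos hκz, abs_of_neg (by linarith), hD, neg_sub]
    have : 0 < α - 1 := by linarith
    calc (α - 1) * (κz * _) ≤ (α - 1) * (κz * 1) := by gcongr
      _ = _ := by ring
  have hint : ∀ z, Integrable (fun x : Metric.sphere (0 : EuclideanSpace ℝ (Fin p)) 1 =>
      Real.exp (α * (z * ⟪μy, (x : EuclideanSpace ℝ (Fin p))⟫) + (1 - α) *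
      (κz * ⟪μz, (x : EuclideanSpace ℝ (Fin p))⟫))) (sphereMeasure p) := by
    intro z
    have hcont : Continuous (fun x : Metric.sphere (0 : EuclideanSpace ℝ (Fin p)) 1 =>
      Real.exp (α * (z * ⟪μy, (x : EuclideanSpace ℝ (Fin p))⟫) + (1 - α) *
      (κz * ⟪μz, (x : EuclideanSpace ℝ (Fin p))⟫))) := by fun_prop
    exact hcont.integrable_of_hasCompactSupport (HasCompactSupport.of_compactSpace _)
  have hlow : ∀ z, 1 ≤ z →
      Real.exp (α * z) ≤ (Real.exp (α + D) / c) * z ^ p * numI p α z κz μy μz := by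
    intro z hz
    have hz0 : 0 < z := by linarith
    have hcz := hcap (1 / z) (by positivity) (by rw [div_le_one hz0]; exact hz)
    have h1 : Real.exp (α * z - α - D) * (sphereMeasure p).real (capSet μy (1 / z))
        ≤ numI p α z κz μy μz := by
      calc Real.exp (α * z - α - D) * (sphereMeasure p).real (capSet μy (1 / z))
          ≤ ∫ x in capSet μy (1 / z), Real.exp (α * (z * ⟪μy, (x : EuclideanSpace ℝ (Fin p))⟫)
            + (1 - α) * (κz * ⟪μz, (x : EuclideanSpace ℝ (Fin p))⟫)) ∂(sphereMeasure p) := by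
            apply setIntegral_ge_of_const_le_real (capSet_meas _ _) (measure_ne_top _ _) _
              (hint z).integrableOn
            intro x hx
            apply Real.exp_le_exp.2
            have hx' : 1 - 1 / z ≤ ⟪μy, (x : EuclideanSpace ℝ (Fin p))⟫ := hx
            have h2 := (abs_le.1 (hDz x)).1
            have h3 : z - 1 ≤ z * ⟪μy, (x : EuclideanSpace ℝ (Fin p))⟫ := by
              calc z - 1 = z * (1 - 1 / z) := by field_simp
                _ ≤ _ := by gcongr
            have h4 : α * (z - 1) ≤ α * (z * ⟪μy, (x : EuclideanSpace ℝ (Fin p))⟫) := by gcongr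
            linarith
        _ ≤ _ := setIntegral_le_integral (hint z)
            (Filter.Eventually.of_forall fun x => (Real.exp_pos _).le)
    have h2 : Real.exp (α * z - α - D) * (c * (1 / z) ^ p) ≤ numI p α z κz μy μz :=
      le_trans (by gcongr) h1
    calc Real.exp (α * z) = (Real.exp (α + D) / c) * z ^ p *
          (Real.exp (α * z - α - D) * (c * (1 / z) ^ p)) := by
          have : Real.exp (α * z) = Real.exp (α + D) * Real.exp (α * z - α - D) := by
            rw [← Real.exp_add]; ring_nf
          rw [this, one_div, inv_pow]
          field_simp
      _ ≤ _ := by gcongr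
  have hpos : ∀ z, 1 ≤ z → 0 < numI p α z κz μy μz := by
    intro z hz
    have hz0 : 0 < z := by linarith
    have h := lt_of_lt_of_le (Real.exp_pos _) (hlow z hz)
    exact (pos_iff_pos_of_mul_pos h).1 (by positivity)
  have hup : ∀ z, 1 ≤ z → numI p α z κz μy μz ≤
      (Real.exp D * ((sphereMeasure p).real Set.univ + 1)) * Real.exp (α * z) := by
    intro z hz
    have h : numI p α z κz μy μz ≤ ∫ x, Real.exp (α * z + D) ∂(sphereMeasure p) := by
      apply integral_mono (hint z) (integrable_const _)
      intro x
      apply Real.exp_le_exp.2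
      have h2 := (abs_le.1 (hDz x)).2
      have h3 := (abs_le.1 (ipb μy hμy x)).2
      have h4 : α * (z * ⟪μy, (x : EuclideanSpace ℝ (Fin p))⟫) ≤ α * (z * 1) := by gcongr
      linarith
    rw [integral_const, smul_eq_mul, Real.exp_add] at h
    refine h.trans ?_
    have := mul_pos (Real.exp_pos (α * z)) (Real.exp_pos D)
    nlinarith
  obtain ⟨b, hb, hbz⟩ := log_two_sided (fun z => numI p α z κz μy μz) (fun z => α * z) _ _ p
    (by positivity) (by positivity) hpos hlow hup
  exact ⟨b, hb, fun z hz => ⟨hpos z hz, hbz z hz⟩⟩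

end cap

/-- The Rényi divergence of order `α > 1` between two von Mises–Fisher
distributions is `O(ln κ_y)` as `κ_y → ∞`. -/
theorem renyi_divergence_bigO_log (p : ℕ) (hp : 2 ≤ p) (α : ℝ) (hα : 1 < α)
    (κz : ℝ) (hκz : 0 < κz)
    (μy μz : EuclideanSpace ℝ (Fin p)) (hμy : ‖μy‖ = 1) (hμz : ‖μz‖ = 1) :
    ∃ C > (0 : ℝ), ∃ K : ℝ, max κz (Real.exp 1) ≤ K ∧
      ∀ κy ≥ K, |renyiDiv p α κy κz μy μz| ≤ C * Real.log κy := by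
  have hν : 0 ≤ nuOf p := by
    unfold nuOf
    have : (2 : ℝ) ≤ p := by exact_mod_cast hp
    linarith
  obtain ⟨a, ha, haz⟩ := vmfC_log (nuOf p) hν
  obtain ⟨b, hb, hbz⟩ := numI_log hp α hα κz hκz μy μz hμy hμz
  have hCz := vmfC_pos (nuOf p) κz hν hκz
  set L := Real.log (vmfC (nuOf p) κz) with hL
  have hα1 : 0 < α - 1 := by linarith
  refine ⟨(1 / (α - 1)) * (2 * α * a + 2 * b + (α - 1) * |L| + 1), by positivity,
    max κz (Real.exp 1), le_rfl, fun κ hκ => ?_⟩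
  have hκe : Real.exp 1 ≤ κ := (le_max_right _ _).trans hκ
  have hκ1 : 1 ≤ κ := (Real.one_le_exp (by norm_num)).trans hκe
  have hκ0 : 0 < κ := by linarith
  have hlog : 1 ≤ Real.log κ := by
    rw [Real.le_log_iff_exp_le hκ0]; exact hκe
  have hCy := vmfC_pos (nuOf p) κ hν hκ0
  obtain ⟨hN, hNb⟩ := hbz κ hκ1
  have hCb := haz κ hκ1
  have key : (∫ x : Metric.sphere (0 : EuclideanSpace ℝ (Fin p)) 1,
      vmf p κ μy (x : EuclideanSpace ℝ (Fin p)) ^ α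
        * vmf p κz μz (x : EuclideanSpace ℝ (Fin p)) ^ (1 - α) ∂(sphereMeasure p))
      = ((vmfC (nuOf p) κ ^ α)⁻¹ * (vmfC (nuOf p) κz ^ (1 - α))⁻¹) * numI p α κ κz μy μz := by
    unfold numI
    rw [← integral_const_mul]
    congr 1
    funext x
    unfold vmf
    rw [Real.div_rpow (Real.exp_pos _).le hCy.le, Real.div_rpow (Real.exp_pos _).le hCz.le,
      ← Real.exp_mul, ← Real.exp_mul, Real.exp_add, mul_comm α, mul_comm (1 - α)]
    ring
  unfold renyiDiv
  have hP1 := Real.rpow_pos_of_pos hCy α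
  have hP2 := Real.rpow_pos_of_pos hCz (1 - α)
  rw [key, Real.log_mul (by positivity) hN.ne', Real.log_mul (by positivity) (by positivity),
    Real.log_inv, Real.log_inv, Real.log_rpow hCy, Real.log_rpow hCz, ← hL, abs_mul,
    abs_of_pos (by positivity : 0 < 1 / (α - 1)), mul_assoc (1 / (α - 1))]
  apply mul_le_mul_of_nonneg_left _ (by positivity)
  set X := Real.log (vmfC (nuOf p) κ)
  set Y := Real.log (numI p α κ κz μy μz)
  set l := Real.log κ
  have e : -(α * X) + -((1 - α) * L) + Y = -(α * (X - κ)) + (α - 1) * L + (Y - α * κ) := by ring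
  rw [e]
  have t := abs_add_three (-(α * (X - κ))) ((α - 1) * L) (Y - α * κ)
  rw [abs_neg, abs_mul, abs_mul, abs_of_pos hα1, abs_of_pos (by linarith : 0 < α)] at t
  have s1 : α * |X - κ| ≤ α * (a * (2 * l)) := by
    refine mul_le_mul_of_nonneg_left (hCb.trans ?_) (by linarith)
    exact mul_le_mul_of_nonneg_left (by linarith) ha
  have s2 : |Y - α * κ| ≤ b * (2 * l) :=
    hNb.trans (mul_le_mul_of_nonneg_left (by linarith) hb)
  have s3 : (α - 1) * |L| * 1 ≤ (α - 1) * |L| * l := by gcongr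
  nlinarith
end

section
/- Let y be a von Mises–Fisher random vector on S_p with parameters (κ_y, μ_y). (i) If z is von Mises–Fisher with parameters (κ_z, μ_z) satisfying ‖2κ_y μ_y − κ_z μ_z‖₂ = 0 (equivalently κ_z = 2κ_y and μ_z = μ_y), then the χ-square distance of y from z equals d_χ(y,z) = κ_y^ν·I_ν(2κ_y)/(4^ν·Γ(ν+1)·I_ν(κ_y)²) − 1. (ii) If instead z is uniformly distributed on S_p, the χ-square distance of y from z is given by the same expression. -/
open MeasureTheory Real
open scoped RealInnerProductSpace

/-- The χ-square distance of `f_p(·;κ_y,μ_y)` from `f_p(·;κ_z,μ_z)`. -/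
noncomputable def chiSqDist (p : ℕ) (κy κz : ℝ) (μy μz : EuclideanSpace ℝ (Fin p)) : ℝ :=
  (∫ x : Metric.sphere (0 : EuclideanSpace ℝ (Fin p)) 1,
      vmf p κy μy (x : EuclideanSpace ℝ (Fin p)) ^ 2
        / vmf p κz μz (x : EuclideanSpace ℝ (Fin p)) ∂(sphereMeasure p)) - 1

/-- The χ-square distance of `f_p(·;κ_y,μ_y)` from the uniform distribution on
the sphere. -/
noncomputable def chiSqDistUniform (p : ℕ) (κy : ℝ) (μy : EuclideanSpace ℝ (Fin p)) : ℝ :=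
  (∫ x : Metric.sphere (0 : EuclideanSpace ℝ (Fin p)) 1,
      vmf p κy μy (x : EuclideanSpace ℝ (Fin p)) ^ 2 / uniformDensity p ∂(sphereMeasure p)) - 1


open Set in
lemma gauss_integrable (p : ℕ) (μ : EuclideanSpace ℝ (Fin p)) (t : ℝ) :
    Integrable (fun v : EuclideanSpace ℝ (Fin p) => rexp (-‖v‖ ^ 2) * rexp (t * ⟪μ, v⟫)) := by
  have h := (GaussianFourier.integrable_cexp_neg_mul_sq_norm_add (b := 1) (by simp) (t : ℂ) μ).re
  refine h.congr (Filter.Eventually.of_forall fun v => ?_)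
  have : (-1 * (‖v‖ : ℂ) ^ 2 + (t : ℂ) * ((⟪μ, v⟫ : ℝ) : ℂ)) = ((-‖v‖ ^ 2 + t * ⟪μ, v⟫ : ℝ) : ℂ) := by
    push_cast; ring
  simp only [this, ← Complex.ofReal_exp]
  rw [← Real.exp_add]
  simp only [RCLike.re_to_complex, Complex.ofReal_re]

lemma gauss_mgf (p : ℕ) (μ : EuclideanSpace ℝ (Fin p)) (hμ : ‖μ‖ = 1) (t : ℝ) :
    ∫ v : EuclideanSpace ℝ (Fin p), rexp (-‖v‖ ^ 2) * rexp (t * ⟪μ, v⟫)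
      = π ^ ((p : ℝ) / 2) * rexp (t ^ 2 / 4) := by
  have h := GaussianFourier.integral_cexp_neg_mul_sq_norm_add (b := 1) (by simp) (t : ℂ) μ
  have h2 : ∀ v : EuclideanSpace ℝ (Fin p), (-1 * (‖v‖ : ℂ) ^ 2 + (t : ℂ) * ((⟪μ, v⟫ : ℝ) : ℂ)) = ((-‖v‖ ^ 2 + t * ⟪μ, v⟫ : ℝ) : ℂ) := by
    intro v; push_cast; ring
  simp only [h2, ← Complex.ofReal_exp] at h
  rw [integral_complex_ofReal] at h
  simp only [← Real.exp_add]
  apply Complex.ofReal_injective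
  rw [h, hμ]
  push_cast
  rw [Complex.ofReal_cpow Real.pi_pos.le]
  simp

/-- Taylor coefficients of `exp (t^2/4)`. -/
noncomputable def gcoef (n : ℕ) : ℝ :=
  if Even n then 1 / (4 ^ (n / 2) * (n / 2).factorial) else 0

lemma gcoef_hasSum_iff (a : ℕ → ℝ) (s : ℝ) :
    HasSum (fun n => a n * gcoef n) s ↔
      HasSum (fun k => a (2 * k) * (1 / (4 ^ k * k.factorial))) s := by
  have hinj : Function.Injective (fun k : ℕ => 2 * k) := fun a b h => by
    simpa using h
  rw [← hinj.hasSum_iff]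
  · simp [Function.comp_def, gcoef]
  · intro x hx
    have : ¬ Even x := by
      rintro ⟨y, hy⟩
      exact hx ⟨y, by simp; omega⟩
    simp [gcoef, this]

lemma gcoef_series (t : ℝ) : HasSum (fun n => t ^ n * gcoef n) (rexp (t ^ 2 / 4)) := by
  rw [gcoef_hasSum_iff]
  have h := NormedSpace.expSeries_div_hasSum_exp (𝔸 := ℝ) (t ^ 2 / 4)
  rw [← Real.exp_eq_exp_ℝ] at h
  have e : (fun k : ℕ => t ^ (2 * k) * (1 / (4 ^ k * (k.factorial : ℝ))))
      = fun k : ℕ => (t ^ 2 / 4) ^ k / (k.factorial : ℝ) := by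
    funext k
    rw [pow_mul, div_pow]
    field_simp
  rw [e]
  exact h

open ProbabilityTheory in
lemma gauss_moment (p : ℕ) (μ : EuclideanSpace ℝ (Fin p)) (hμ : ‖μ‖ = 1) (n : ℕ) :
    ∫ v : EuclideanSpace ℝ (Fin p), rexp (-‖v‖ ^ 2) * ⟪μ, v⟫ ^ n
      = π ^ ((p : ℝ) / 2) * n.factorial * gcoef n := by
  let d : EuclideanSpace ℝ (Fin p) → NNReal := fun v => (rexp (-‖v‖ ^ 2)).toNNReal
  have hd : Measurable d := by fun_prop
  have hdv : ∀ v, (d v : ℝ) = rexp (-‖v‖ ^ 2) := fun v => Real.coe_toNNReal _ (by positivity)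
  let G : Measure (EuclideanSpace ℝ (Fin p)) := volume.withDensity (fun x => d x)
  let X : EuclideanSpace ℝ (Fin p) → ℝ := fun v => ⟪μ, v⟫
  have hG : ∀ g : EuclideanSpace ℝ (Fin p) → ℝ, ∫ v, g v ∂G = ∫ v, rexp (-‖v‖ ^ 2) * g v := by
    intro g
    simp only [G]
    rw [integral_withDensity_eq_integral_smul hd]
    simp only [NNReal.smul_def, hdv, smul_eq_mul]
  have hset : integrableExpSet X G = Set.univ := by
    ext t
    simp only [integrableExpSet, Set.mem_ofPred_eq, Set.mem_univ, iff_true, G]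
    rw [integrable_withDensity_iff_integrable_smul hd]
    simp only [NNReal.smul_def, hdv, smul_eq_mul]
    exact gauss_integrable p μ t
  have h1 := hasFPowerSeriesAt_mgf (X := X) (μ := G) (v := 0) (by simp [hset])
  have h2 : HasFPowerSeriesAt (mgf X G)
      (FormalMultilinearSeries.ofScalars ℝ (fun n => π ^ ((p : ℝ) / 2) * gcoef n)) 0 := by
    rw [hasFPowerSeriesAt_iff]
    refine Filter.Eventually.of_forall fun t => ?_
    simp only [FormalMultilinearSeries.coeff_ofScalars, zero_add, mgf, hG, X, smul_eq_mul]
    rw [gauss_mgf p μ hμ t]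
    simpa [mul_left_comm] using (gcoef_series t).mul_left (π ^ ((p : ℝ) / 2))
  have h3 := congrArg (fun s => FormalMultilinearSeries.coeff s n) (h1.eq_formalMultilinearSeries h2)
  simp only [FormalMultilinearSeries.coeff_ofScalars, hG, X, zero_mul, Real.exp_zero, mul_one] at h3
  have : (n.factorial : ℝ) ≠ 0 := by positivity
  field_simp at h3
  rw [h3]; ring

lemma radial (p n : ℕ) (hp : 2 ≤ p) :
    ∫ r : Set.Ioi (0 : ℝ), rexp (-(r : ℝ) ^ 2) * (r : ℝ) ^ n ∂(Measure.volumeIoiPow (p - 1))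
      = Real.Gamma (((n : ℝ) + p) / 2) / 2 := by
  simp only [Measure.volumeIoiPow, ENNReal.ofReal]
  rw [integral_withDensity_eq_integral_smul (by fun_prop),
    integral_subtype_comap measurableSet_Ioi
      fun a : ℝ ↦ Real.toNNReal (a ^ (p - 1)) • (rexp (-a ^ 2) * a ^ n)]
  have h := integral_rpow_mul_exp_neg_rpow (p := 2) (q := (n : ℝ) + p - 1) (by norm_num)
    (by have : (2 : ℝ) ≤ p := by exact_mod_cast hp
        have : (0 : ℝ) ≤ n := by positivity
        linarith)
  rw [show ((n : ℝ) + p - 1 + 1) / 2 = ((n : ℝ) + p) / 2 by ring] at h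
  rw [div_eq_inv_mul, ← one_div, ← h]
  refine setIntegral_congr_fun measurableSet_Ioi fun x hx => ?_
  have hx : 0 < x := hx
  rw [NNReal.smul_def, Real.coe_toNNReal _ (pow_nonneg hx.le _),
    show (n : ℝ) + p - 1 = ((n + (p - 1) : ℕ) : ℝ) by push_cast [Nat.cast_sub (by omega : 1 ≤ p)]; ring,
    Real.rpow_natCast, pow_add, Real.rpow_two, smul_eq_mul]
  ring

lemma sphere_moment (p : ℕ) (hp : 2 ≤ p) (μ : EuclideanSpace ℝ (Fin p)) (hμ : ‖μ‖ = 1) (n : ℕ) :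
    (∫ x : Metric.sphere (0 : EuclideanSpace ℝ (Fin p)) 1,
      ⟪μ, (x : EuclideanSpace ℝ (Fin p))⟫ ^ n ∂(sphereMeasure p))
      * (Real.Gamma (((n : ℝ) + p) / 2) / 2) = π ^ ((p : ℝ) / 2) * n.factorial * gcoef n := by
  have : Nontrivial (EuclideanSpace ℝ (Fin p)) := ⟨μ, 0, by rintro rfl; simp at hμ⟩
  rw [← gauss_moment p μ hμ n, ← radial p n hp, sphereMeasure]
  have hmp := (volume : Measure (EuclideanSpace ℝ (Fin p))).measurePreserving_homeomorphUnitSphereProd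
  rw [finrank_euclideanSpace_fin] at hmp
  have h := hmp.integral_comp (Homeomorph.measurableEmbedding _)
    (fun q => ⟪μ, (q.1 : EuclideanSpace ℝ (Fin p))⟫ ^ n * (rexp (-(q.2 : ℝ) ^ 2) * (q.2 : ℝ) ^ n))
  rw [integral_prod_mul (fun q : Metric.sphere (0 : EuclideanSpace ℝ (Fin p)) 1 => ⟪μ, (q : EuclideanSpace ℝ (Fin p))⟫ ^ n)
    (fun q : Set.Ioi (0 : ℝ) => (rexp (-(q : ℝ) ^ 2) * (q : ℝ) ^ n))] at h
  rw [← h]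
  have hr : ∫ v : EuclideanSpace ℝ (Fin p), rexp (-‖v‖ ^ 2) * ⟪μ, v⟫ ^ n
      = ∫ v : ({(0)}ᶜ : Set (EuclideanSpace ℝ (Fin p))),
        rexp (-‖(v : EuclideanSpace ℝ (Fin p))‖ ^ 2) * ⟪μ, (v : EuclideanSpace ℝ (Fin p))⟫ ^ n
          ∂((volume : Measure (EuclideanSpace ℝ (Fin p))).comap (↑)) := by
    rw [integral_subtype_comap (measurableSet_singleton (0 : EuclideanSpace ℝ (Fin p))).compl
      fun v : EuclideanSpace ℝ (Fin p) ↦ rexp (-‖v‖ ^ 2) * ⟪μ, v⟫ ^ n,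
      restrict_compl_singleton]
  rw [hr]
  congr 1
  funext x
  have hx : ‖(x : EuclideanSpace ℝ (Fin p))‖ ≠ 0 := norm_ne_zero_iff.mpr x.2
  simp [real_inner_smul_right]
  field_simp
  rw [← mul_pow, div_mul_cancel₀ _ hx]

lemma sphere_exp_hasSum_s8 (p : ℕ) (μ : EuclideanSpace ℝ (Fin p)) (hμ : ‖μ‖ = 1) (κ : ℝ) :
    HasSum (fun n : ℕ => κ ^ n / n.factorial * ∫ x : Metric.sphere (0 : EuclideanSpace ℝ (Fin p)) 1,
      ⟪μ, (x : EuclideanSpace ℝ (Fin p))⟫ ^ n ∂(sphereMeasure p))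
      (∫ x : Metric.sphere (0 : EuclideanSpace ℝ (Fin p)) 1,
        rexp (κ * ⟪μ, (x : EuclideanSpace ℝ (Fin p))⟫) ∂(sphereMeasure p)) := by
  have : IsFiniteMeasure (sphereMeasure p) := by unfold sphereMeasure; infer_instance
  simp only [← integral_const_mul]
  refine hasSum_integral_of_dominated_convergence (fun n _ => |κ| ^ n / n.factorial) ?_ ?_ ?_ ?_ ?_
  · intro n
    exact (by fun_prop : Continuous _).aestronglyMeasurable
  · intro n
    refine Filter.Eventually.of_forall fun x => ?_
    have hx : |⟪μ, (x : EuclideanSpace ℝ (Fin p))⟫| ≤ 1 := by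
      have := abs_real_inner_le_norm μ (x : EuclideanSpace ℝ (Fin p))
      simpa [hμ] using this
    rw [norm_mul, norm_div, norm_pow, norm_pow, Real.norm_natCast, Real.norm_eq_abs, Real.norm_eq_abs]
    exact mul_le_of_le_one_right (by positivity) (pow_le_one₀ (abs_nonneg _) hx)
  · exact Filter.Eventually.of_forall fun x => Real.summable_pow_div_factorial _
  · exact integrable_const _
  · refine Filter.Eventually.of_forall fun x => ?_
    have h := NormedSpace.expSeries_div_hasSum_exp (𝔸 := ℝ) (κ * ⟪μ, (x : EuclideanSpace ℝ (Fin p))⟫)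
    rw [← Real.exp_eq_exp_ℝ] at h
    have e : (fun n : ℕ => κ ^ n / (n.factorial : ℝ) * ⟪μ, (x : EuclideanSpace ℝ (Fin p))⟫ ^ n)
        = fun n : ℕ => (κ * ⟪μ, (x : EuclideanSpace ℝ (Fin p))⟫) ^ n / (n.factorial : ℝ) := by
      funext n
      rw [mul_pow]; ring
    rw [e]
    exact h

lemma sphere_exp (p : ℕ) (hp : 2 ≤ p) (μ : EuclideanSpace ℝ (Fin p)) (hμ : ‖μ‖ = 1) (κ : ℝ)
    (hκ : 0 < κ) :
    ∫ x : Metric.sphere (0 : EuclideanSpace ℝ (Fin p)) 1,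
        rexp (κ * ⟪μ, (x : EuclideanSpace ℝ (Fin p))⟫) ∂(sphereMeasure p) = vmfC (nuOf p) κ := by
  have h := sphere_exp_hasSum_s8 p μ hμ κ
  have hp0 : (0 : ℝ) < p := by positivity
  have e : ∀ n : ℕ, κ ^ n / n.factorial * ∫ x : Metric.sphere (0 : EuclideanSpace ℝ (Fin p)) 1,
      ⟪μ, (x : EuclideanSpace ℝ (Fin p))⟫ ^ n ∂(sphereMeasure p) =
      (κ ^ n * (2 * π ^ ((p : ℝ) / 2) / Real.Gamma (((n : ℝ) + p) / 2))) * gcoef n := by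
    intro n
    have hg : 0 < Real.Gamma (((n : ℝ) + p) / 2) := Real.Gamma_pos_of_pos (by positivity)
    have h1 := sphere_moment p hp μ hμ n
    have : (n.factorial : ℝ) ≠ 0 := by positivity
    field_simp
    field_simp at h1
    linear_combination h1
  simp only [e] at h
  rw [gcoef_hasSum_iff] at h
  have hν : nuOf p + 1 = (p : ℝ) / 2 := by simp [nuOf]
  have h2 : HasSum (fun k : ℕ => 2 * π ^ ((p : ℝ) / 2) * ((κ / 2) ^ (2 * k) / (Nat.factorial k * Real.Gamma (nuOf p + k + 1))))
      (∫ x : Metric.sphere (0 : EuclideanSpace ℝ (Fin p)) 1,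
        rexp (κ * ⟪μ, (x : EuclideanSpace ℝ (Fin p))⟫) ∂(sphereMeasure p)) := by
    convert h using 2 with k
    have : nuOf p + k + 1 = (((2 * k : ℕ) : ℝ) + p) / 2 := by
      push_cast; linear_combination hν
    rw [this, div_pow, pow_mul 2 2 k]
    norm_num
    field_simp
  rw [← h2.tsum_eq, tsum_mul_left, vmfC, besselI, hν, Real.div_rpow hκ.le (by norm_num),
    Real.mul_rpow (by norm_num) Real.pi_pos.le, ← hν, Real.rpow_add_one (by norm_num : (2 : ℝ) ≠ 0)]
  have : κ ^ nuOf p ≠ 0 := by positivity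
  field_simp

lemma chisq_algebra (ν κ : ℝ) (hκ : 0 < κ) (hΓ : 0 < Real.Gamma (ν + 1)) :
    vmfC ν (2 * κ) / vmfC ν κ ^ 2 * (2 * π ^ (ν + 1) / Real.Gamma (ν + 1)) =
      κ ^ ν * besselI ν (2 * κ) / ((4 : ℝ) ^ ν * Real.Gamma (ν + 1) * besselI ν κ ^ 2) := by
  unfold vmfC
  by_cases hI : besselI ν κ = 0
  · simp [hI]
  rw [Real.mul_rpow (by norm_num) Real.pi_pos.le, Real.mul_rpow (by norm_num) hκ.le,
    show (4 : ℝ) = 2 * 2 by norm_num, Real.mul_rpow (by norm_num) (by norm_num),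
    Real.rpow_add_one (by norm_num : (2 : ℝ) ≠ 0)]
  have h1 : (0 : ℝ) < κ ^ ν := by positivity
  have h2 : (0 : ℝ) < 2 ^ ν := by positivity
  have h3 : (0 : ℝ) < π ^ (ν + 1) := by positivity
  field_simp

/-- χ-square distance of a von Mises–Fisher distribution (i) from the
von Mises–Fisher distribution with `‖2κ_y μ_y − κ_z μ_z‖₂ = 0`, and (ii) from the
uniform distribution on the sphere: both equal
`κ_y^ν·I_ν(2κ_y)/(4^ν·Γ(ν+1)·I_ν(κ_y)²) − 1`. -/
theorem chisq_distance_vmf_degenerate_and_uniform (p : ℕ) (hp : 2 ≤ p)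
    (κy : ℝ) (hκy : 0 < κy)
    (μy : EuclideanSpace ℝ (Fin p)) (hμy : ‖μy‖ = 1) :
    (∀ κz : ℝ, 0 < κz → ∀ μz : EuclideanSpace ℝ (Fin p), ‖μz‖ = 1 →
        ‖(2 * κy) • μy - κz • μz‖ = 0 →
        chiSqDist p κy κz μy μz
          = κy ^ nuOf p * besselI (nuOf p) (2 * κy)
              / ((4 : ℝ) ^ nuOf p * Real.Gamma (nuOf p + 1) * besselI (nuOf p) κy ^ 2) - 1)
      ∧ chiSqDistUniform p κy μy
          = κy ^ nuOf p * besselI (nuOf p) (2 * κy)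
              / ((4 : ℝ) ^ nuOf p * Real.Gamma (nuOf p + 1) * besselI (nuOf p) κy ^ 2) - 1 := by
  have hν : nuOf p + 1 = (p : ℝ) / 2 := by simp [nuOf]
  have hp0 : (0 : ℝ) < p := by positivity
  have hΓ : 0 < Real.Gamma (nuOf p + 1) := Real.Gamma_pos_of_pos (by rw [hν]; positivity)
  constructor
  · intro κz hκz μz hμz h
    have h0 : (2 * κy) • μy = κz • μz := sub_eq_zero.mp (norm_eq_zero.mp h)
    have hk : κz = 2 * κy := by
      have := congrArg norm h0
      rw [norm_smul, norm_smul, hμy, hμz, Real.norm_of_nonneg (by positivity),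
        Real.norm_of_nonneg hκz.le] at this
      linarith
    subst hk
    have hm : μy = μz := smul_right_injective _ hκz.ne' h0
    subst hm
    rw [← chisq_algebra (nuOf p) κy hκy hΓ, chiSqDist]
    have e : ∀ x : Metric.sphere (0 : EuclideanSpace ℝ (Fin p)) 1,
        vmf p κy μy (x : EuclideanSpace ℝ (Fin p)) ^ 2
        / vmf p (2 * κy) μy (x : EuclideanSpace ℝ (Fin p)) =
        vmfC (nuOf p) (2 * κy) / vmfC (nuOf p) κy ^ 2 *
          ⟪μy, (x : EuclideanSpace ℝ (Fin p))⟫ ^ 0 := by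
      intro x
      unfold vmf
      rw [mul_assoc 2 κy, div_pow, ← Real.exp_nat_mul, Nat.cast_ofNat, div_div_div_eq,
        mul_comm (vmfC (nuOf p) κy ^ 2), mul_div_mul_left _ _ (Real.exp_ne_zero _), pow_zero, mul_one]
    simp only [e]
    rw [integral_const_mul]
    have h1 := sphere_moment p hp μy hμy 0
    have hg : gcoef 0 = 1 := by simp [gcoef]
    rw [hg, Nat.cast_zero, zero_add, ← hν] at h1
    have h2 : (∫ x : Metric.sphere (0 : EuclideanSpace ℝ (Fin p)) 1,
      ⟪μy, (x : EuclideanSpace ℝ (Fin p))⟫ ^ 0 ∂(sphereMeasure p)) =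
        2 * π ^ (nuOf p + 1) / Real.Gamma (nuOf p + 1) := by
      rw [eq_div_iff hΓ.ne']
      simp only [Nat.factorial_zero, Nat.cast_one, mul_one] at h1
      linarith
    rw [h2]
  · rw [← chisq_algebra (nuOf p) κy hκy hΓ, chiSqDistUniform]
    have e : ∀ x : Metric.sphere (0 : EuclideanSpace ℝ (Fin p)) 1,
        vmf p κy μy (x : EuclideanSpace ℝ (Fin p)) ^ 2 / uniformDensity p =
        rexp (2 * κy * ⟪μy, (x : EuclideanSpace ℝ (Fin p))⟫) *
          (1 / vmfC (nuOf p) κy ^ 2 * (2 * π ^ (nuOf p + 1) / Real.Gamma (nuOf p + 1))) := by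
      intro x
      unfold vmf uniformDensity
      rw [mul_assoc 2 κy, div_pow, ← Real.exp_nat_mul, Nat.cast_ofNat, div_div_eq_mul_div]
      ring
    simp only [e]
    rw [integral_mul_const, sphere_exp p hp μy hμy (2 * κy) (by positivity)]
    ring
end

section
/- Let y and z be von Mises–Fisher random vectors on S_p with parameters (κ_y, μ_y) and (κ_z, μ_z), and set κ_h = ‖(κ_y/2)μ_y + (κ_z/2)μ_z‖₂. If κ_h > 0, then the squared-Hellinger distance between y and z equals d_h(y,z)² = 2·(1 − κ_y^{ν/2}·κ_z^{ν/2}·I_ν(κ_h)/(κ_h^ν·I_ν(κ_y)^{1/2}·I_ν(κ_z)^{1/2})). -/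
open MeasureTheory Real
open scoped RealInnerProductSpace

/-- The squared-Hellinger distance between `f_p(·;κ_y,μ_y)` and `f_p(·;κ_z,μ_z)`. -/
noncomputable def hellingerSq (p : ℕ) (κy κz : ℝ) (μy μz : EuclideanSpace ℝ (Fin p)) : ℝ :=
  2 * (1 - ∫ x : Metric.sphere (0 : EuclideanSpace ℝ (Fin p)) 1,
      (vmf p κy μy (x : EuclideanSpace ℝ (Fin p))
        * vmf p κz μz (x : EuclideanSpace ℝ (Fin p))) ^ ((1 : ℝ) / 2) ∂(sphereMeasure p))

lemma aux_gamma_half (k : ℕ) :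
    Real.Gamma (k + 1 / 2) = (Nat.factorial (2 * k)) * √π / (4 ^ k * Nat.factorial k) := by
  induction k with
  | zero => simp [-one_div, Real.Gamma_one_half_eq]
  | succ k ih =>
    have h : ((k + 1 : ℕ) : ℝ) + 1 / 2 = (k + 1 / 2) + 1 := by push_cast; ring
    rw [h, Real.Gamma_add_one (by positivity), ih]
    have : 2 * (k + 1) = 2 * k + 1 + 1 := by ring
    rw [this, Nat.factorial_succ, Nat.factorial_succ, Nat.factorial_succ]
    have hk : (Nat.factorial k : ℝ) ≠ 0 := by positivity
    push_cast
    field_simp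
    ring

lemma aux_radial (n : ℕ) :
    ∫ r in Set.Ioi (0 : ℝ), r ^ n * Real.exp (-r ^ 2) = (1 / 2) * Real.Gamma ((n + 1) / 2) := by
  have h := integral_rpow_mul_exp_neg_rpow (p := 2) (q := n) (by norm_num)
    (by have : (0 : ℝ) ≤ n := by positivity
        linarith)
  rw [← h]
  simp

lemma aux_line_even (k : ℕ) :
    ∫ t : ℝ, t ^ (2 * k) * Real.exp (-t ^ 2) = Real.Gamma (k + 1 / 2) := by
  have h := integral_comp_abs (f := fun t : ℝ => t ^ (2 * k) * Real.exp (-t ^ 2))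
  simp only [sq_abs, pow_mul] at h
  simp only [pow_mul]
  rw [h]
  have h2 := aux_radial (2 * k)
  simp only [pow_mul] at h2
  rw [h2]
  push_cast
  rw [← mul_assoc]
  norm_num
  congr 1
  ring

lemma aux_line_odd (n : ℕ) (hn : Odd n) :
    ∫ t : ℝ, t ^ n * Real.exp (-t ^ 2) = 0 := by
  have h := integral_neg_eq_self (fun t : ℝ => t ^ n * Real.exp (-t ^ 2)) volume
  simp only [hn.neg_pow, neg_sq, neg_mul, integral_neg] at h
  linarith

lemma aux_gauss (p : ℕ) (hp : 0 < p) (v : EuclideanSpace ℝ (Fin p)) (hv : 0 < ‖v‖) (n : ℕ) :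
    ∫ x : EuclideanSpace ℝ (Fin p), ⟪v, x⟫ ^ n * Real.exp (-‖x‖ ^ 2)
      = ‖v‖ ^ n * (∫ t : ℝ, t ^ n * Real.exp (-t ^ 2)) * (√π) ^ (p - 1) := by
  set i0 : Fin p := ⟨0, hp⟩
  have hon : Orthonormal ℝ (({i0} : Set (Fin p)).domRestrict
      (fun _ : Fin p => (‖v‖⁻¹ • v))) := by
    constructor
    · intro i
      simp [norm_smul, hv.ne']
    · intro i j hij
      exact absurd (Subsingleton.elim i j) hij
  obtain ⟨b, hb⟩ := hon.exists_orthonormalBasis_extension_of_card_eq (by simp)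
  have hb0 : b i0 = ‖v‖⁻¹ • v := hb i0 rfl
  have hv0 : v = ‖v‖ • b i0 := by rw [hb0, smul_smul, mul_inv_cancel₀ hv.ne', one_smul]
  have h1 : ∀ x : EuclideanSpace ℝ (Fin p), ⟪v, x⟫ ^ n * Real.exp (-‖x‖ ^ 2)
      = (fun y : EuclideanSpace ℝ (Fin p) => (‖v‖ * y i0) ^ n * Real.exp (-‖y‖ ^ 2)) (b.repr x) := by
    intro x
    simp only [b.repr.norm_map, b.repr_apply_apply]
    conv_lhs => rw [hv0, inner_smul_left]
    simp
  simp_rw [h1]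
  have h2 := b.measurePreserving_repr.integral_comp
    (b.repr.toHomeomorph.measurableEmbedding)
    (fun y : EuclideanSpace ℝ (Fin p) => (‖v‖ * y i0) ^ n * Real.exp (-‖y‖ ^ 2))
  rw [h2]
  have h3 := (EuclideanSpace.volume_preserving_symm_measurableEquiv_toLp (Fin p)).symm.integral_comp
    (MeasurableEquiv.measurableEmbedding _)
    (fun y : EuclideanSpace ℝ (Fin p) => (‖v‖ * y i0) ^ n * Real.exp (-‖y‖ ^ 2))
  rw [← h3]
  have h4 : ∀ y : Fin p → ℝ, (‖v‖ * y i0) ^ n * Real.exp (-‖WithLp.toLp 2 y‖ ^ 2)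
      = ‖v‖ ^ n * ∏ i, (if i = i0 then y i ^ n else 1) * Real.exp (-(y i) ^ 2) := by
    intro y
    rw [Finset.prod_mul_distrib, ← Real.exp_sum, EuclideanSpace.norm_sq_eq, mul_pow]
    simp [mul_assoc]
  calc _ = ∫ y : Fin p → ℝ, ‖v‖ ^ n *
        ∏ i, (if i = i0 then y i ^ n else 1) * Real.exp (-(y i) ^ 2) := by
        congr 1
        ext y
        exact h4 y
    _ = _ := by
        rw [integral_const_mul, integral_fintype_prod_volume_eq_prod
          (f := fun i (t : ℝ) => (if i = i0 then t ^ n else 1) * Real.exp (-t ^ 2)), mul_assoc]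
        congr 1
        rw [← Finset.mul_prod_erase _ _ (Finset.mem_univ i0)]
        refine congrArg₂ (· * ·) ?_ ?_
        · simp
        · have hg := integral_gaussian 1
          simp only [neg_mul, one_mul, div_one] at hg
          rw [Finset.prod_congr rfl (g := fun _ => √π)]
          · simp
          · intro i hi
            simp [Finset.ne_of_mem_erase hi, hg]

lemma aux_polar (p : ℕ) (hp : 0 < p) (v : EuclideanSpace ℝ (Fin p)) (n : ℕ) :
    ∫ x : EuclideanSpace ℝ (Fin p), ⟪v, x⟫ ^ n * Real.exp (-‖x‖ ^ 2)
      = (∫ x : Metric.sphere (0 : EuclideanSpace ℝ (Fin p)) 1,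
          ⟪v, (x : EuclideanSpace ℝ (Fin p))⟫ ^ n ∂(sphereMeasure p))
        * ((1 / 2) * Real.Gamma (((n + p : ℕ) : ℝ) / 2)) := by
  have : Nonempty (Fin p) := ⟨⟨0, hp⟩⟩
  have : Nontrivial (EuclideanSpace ℝ (Fin p)) := inferInstance
  calc
    ∫ x : (EuclideanSpace ℝ (Fin p)), ⟪v, x⟫ ^ n * Real.exp (-‖x‖ ^ 2)
      = ∫ x : ({(0)}ᶜ : Set (EuclideanSpace ℝ (Fin p))), ⟪v, x.1⟫ ^ n * Real.exp (-‖x.1‖ ^ 2)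
          ∂((volume : Measure (EuclideanSpace ℝ (Fin p))).comap (↑)) := by
      rw [integral_subtype_comap (measurableSet_singleton _).compl
        fun x : (EuclideanSpace ℝ (Fin p)) ↦ ⟪v, x⟫ ^ n * Real.exp (-‖x‖ ^ 2),
        restrict_compl_singleton]
    _ = ∫ x, ⟪v, (x.1 : (EuclideanSpace ℝ (Fin p)))⟫ ^ n * ((x.2 : ℝ) ^ n * Real.exp (-(x.2 : ℝ) ^ 2))
          ∂(volume : Measure (EuclideanSpace ℝ (Fin p))).toSphere.prod (.volumeIoiPow (Module.finrank ℝ (EuclideanSpace ℝ (Fin p)) - 1)) := by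
      rw [← (volume : Measure (EuclideanSpace ℝ (Fin p))).measurePreserving_homeomorphUnitSphereProd.integral_comp
        (Homeomorph.measurableEmbedding _)]
      congr 1
      ext x
      have hx : ‖x.1‖ ≠ 0 := norm_ne_zero_iff.2 x.2
      simp only [homeomorphUnitSphereProd_apply_snd_coe, homeomorphUnitSphereProd_apply_fst_coe,
        inner_smul_right, mul_pow, inv_pow]
      field_simp
    _ = _ := by
      rw [integral_prod_mul (fun x : Metric.sphere (0 : (EuclideanSpace ℝ (Fin p))) 1 => ⟪v, (x : (EuclideanSpace ℝ (Fin p)))⟫ ^ n)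
        (fun r : Set.Ioi (0 : ℝ) => (r : ℝ) ^ n * Real.exp (-(r : ℝ) ^ 2))]
      congr 1
      simp only [Measure.volumeIoiPow, ENNReal.ofReal]
      rw [integral_withDensity_eq_integral_smul,
        integral_subtype_comap measurableSet_Ioi
          fun a ↦ Real.toNNReal (a ^ (Module.finrank ℝ (EuclideanSpace ℝ (Fin p)) - 1)) • (a ^ n * Real.exp (-a ^ 2)),
        setIntegral_congr_fun (g := fun r => r ^ (n + (p - 1)) * Real.exp (-r ^ 2))
          measurableSet_Ioi fun x hx ↦ ?_]
      · rw [aux_radial]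
        congr 3
        have : n + p = n + (p - 1) + 1 := by omega
        rw [this]; push_cast; ring
      · simp only [finrank_euclideanSpace, Fintype.card_fin]
        rw [NNReal.smul_def, Real.coe_toNNReal _ (pow_nonneg (le_of_lt hx) _), smul_eq_mul]
        ring
      · exact (measurable_subtype_coe.pow_const _).real_toNNReal

lemma aux_exp_integral (p : ℕ) (hp : 0 < p) (v : EuclideanSpace ℝ (Fin p)) (hv : 0 < ‖v‖) :
    HasSum (fun k : ℕ => 2 * π ^ ((p : ℝ) / 2) *
        ((‖v‖ / 2) ^ (2 * k) / (Nat.factorial k * Real.Gamma (nuOf p + k + 1))))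
      (∫ x : Metric.sphere (0 : EuclideanSpace ℝ (Fin p)) 1,
        Real.exp ⟪v, (x : EuclideanSpace ℝ (Fin p))⟫ ∂(sphereMeasure p)) := by
  have : IsFiniteMeasure (sphereMeasure p) := by unfold sphereMeasure; infer_instance
  have hmom : ∀ n : ℕ, (∫ x : Metric.sphere (0 : EuclideanSpace ℝ (Fin p)) 1,
        ⟪v, (x : EuclideanSpace ℝ (Fin p))⟫ ^ n ∂(sphereMeasure p))
        * ((1 / 2) * Real.Gamma (((n + p : ℕ) : ℝ) / 2))
        = ‖v‖ ^ n * (∫ t : ℝ, t ^ n * Real.exp (-t ^ 2)) * (√π) ^ (p - 1) := fun n => by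
    rw [← aux_polar p hp, aux_gauss p hp v hv]
  have hs : HasSum (fun n : ℕ => ∫ x : Metric.sphere (0 : EuclideanSpace ℝ (Fin p)) 1,
        ⟪v, (x : EuclideanSpace ℝ (Fin p))⟫ ^ n / (Nat.factorial n : ℝ) ∂(sphereMeasure p))
      (∫ x : Metric.sphere (0 : EuclideanSpace ℝ (Fin p)) 1,
        Real.exp ⟪v, (x : EuclideanSpace ℝ (Fin p))⟫ ∂(sphereMeasure p)) := by
    apply hasSum_integral_of_dominated_convergence
      (fun n _ => ‖v‖ ^ n / (Nat.factorial n : ℝ))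
    · intro n
      apply Continuous.aestronglyMeasurable
      fun_prop
    · intro n
      filter_upwards with x
      rw [norm_div, norm_pow, Real.norm_natCast]
      gcongr
      have := norm_inner_le_norm (𝕜 := ℝ) v (x : EuclideanSpace ℝ (Fin p))
      simpa using this
    · filter_upwards with x
      exact Real.summable_pow_div_factorial _
    · exact integrable_const _
    · filter_upwards with x
      rw [Real.exp_eq_exp_ℝ]
      exact NormedSpace.expSeries_div_hasSum_exp _
  have hinj : Function.Injective (fun k : ℕ => 2 * k) := fun a b h => by
    simpa using h
  rw [← hinj.hasSum_iff] at hs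
  · convert hs using 1
    ext k
    simp only [Function.comp]
    rw [integral_div]
    have h := hmom (2 * k)
    rw [aux_line_even, aux_gamma_half] at h
    have e1 : (((2 * k + p : ℕ) : ℝ) / 2) = nuOf p + k + 1 := by
      unfold nuOf; push_cast; ring
    rw [e1] at h
    have hG : 0 < Real.Gamma (nuOf p + k + 1) := by
      apply Real.Gamma_pos_of_pos
      rw [← e1]
      have : 0 < 2 * k + p := by omega
      positivity
    have e2 : π ^ ((p : ℝ) / 2) = √π * √π ^ (p - 1) := by
      rw [← pow_succ', Nat.sub_add_cancel hp, Real.sqrt_eq_rpow, ← Real.rpow_natCast,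
        ← Real.rpow_mul pi_pos.le]
      congr 1; ring
    rw [e2]
    have hM := eq_div_of_mul_eq (by positivity) h
    rw [hM]
    have : (Nat.factorial (2 * k) : ℝ) ≠ 0 := by positivity
    have e3 : (2 : ℝ) ^ (2 * k) = 4 ^ k := by rw [pow_mul]; norm_num
    rw [div_pow, e3]
    field_simp
  · intro n hn
    have hodd : Odd n := by
      rw [← Nat.not_even_iff_odd]
      rintro ⟨m, hm⟩
      exact hn ⟨m, by simp only; omega⟩
    rw [integral_div]
    have h := hmom n
    rw [aux_line_odd n hodd] at h
    have hG : 0 < Real.Gamma (((n + p : ℕ) : ℝ) / 2) := by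
      apply Real.Gamma_pos_of_pos
      have : 0 < n + p := by omega
      positivity
    have : _ = (0 : ℝ) := (mul_eq_zero.1 (h.trans (by ring))).resolve_right (by positivity)
    rw [this, zero_div]

lemma aux_bessel_pos (p : ℕ) (hp : 0 < p) (κ : ℝ) (hκ : 0 < κ) : 0 < besselI (nuOf p) κ := by
  have : Nonempty (Fin p) := ⟨⟨0, hp⟩⟩
  unfold besselI
  apply mul_pos (by positivity)
  have hpos : ∀ k : ℕ,
      0 < (κ / 2) ^ (2 * k) / (Nat.factorial k * Real.Gamma (nuOf p + k + 1)) := by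
    intro k
    have : 0 < Real.Gamma (nuOf p + k + 1) := by
      apply Real.Gamma_pos_of_pos
      unfold nuOf
      have : (0 : ℝ) < p := by exact_mod_cast hp
      have : (0 : ℝ) ≤ k := by positivity
      linarith
    positivity
  have hn : ‖κ • EuclideanSpace.single (⟨0, hp⟩ : Fin p) (1 : ℝ)‖ = κ := by
    simp [norm_smul, abs_of_pos hκ]
  have hs := (aux_exp_integral p hp (κ • EuclideanSpace.single (⟨0, hp⟩ : Fin p) (1 : ℝ))
    (by rw [hn]; exact hκ)).summable
  rw [hn] at hs
  rw [summable_mul_left_iff (by positivity)] at hs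
  exact hs.tsum_pos (fun k => (hpos k).le) 0 (hpos 0)

lemma aux_vmfC (p : ℕ) (hp : 0 < p) (v : EuclideanSpace ℝ (Fin p)) (hv : 0 < ‖v‖) :
    ∫ x : Metric.sphere (0 : EuclideanSpace ℝ (Fin p)) 1,
        Real.exp ⟪v, (x : EuclideanSpace ℝ (Fin p))⟫ ∂(sphereMeasure p)
      = vmfC (nuOf p) ‖v‖ := by
  rw [← (aux_exp_integral p hp v hv).tsum_eq, tsum_mul_left]
  unfold vmfC besselI
  have e : (p : ℝ) / 2 = nuOf p + 1 := by unfold nuOf; ring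
  rw [e, Real.mul_rpow (by norm_num) pi_pos.le, Real.div_rpow hv.le (by norm_num),
    Real.rpow_add_one (by norm_num : (2 : ℝ) ≠ 0)]
  have h1 : (0 : ℝ) < 2 ^ nuOf p := by positivity
  have h2 : 0 < ‖v‖ ^ nuOf p := by positivity
  field_simp

/-- Squared-Hellinger distance between two von Mises–Fisher distributions when
`κ_h > 0`. -/
theorem hellinger_sq_vmf (p : ℕ) (hp : 2 ≤ p)
    (κy κz : ℝ) (hκy : 0 < κy) (hκz : 0 < κz)
    (μy μz : EuclideanSpace ℝ (Fin p)) (hμy : ‖μy‖ = 1) (hμz : ‖μz‖ = 1)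
    (κh : ℝ) (hκh : κh = ‖(κy / 2) • μy + (κz / 2) • μz‖) (hκhpos : 0 < κh) :
    hellingerSq p κy κz μy μz
      = 2 * (1 - κy ^ (nuOf p / 2) * κz ^ (nuOf p / 2) * besselI (nuOf p) κh
          / (κh ^ nuOf p * besselI (nuOf p) κy ^ ((1 : ℝ) / 2)
              * besselI (nuOf p) κz ^ ((1 : ℝ) / 2))) := by
  have hp0 : 0 < p := by omega
  have hBy := aux_bessel_pos p hp0 κy hκy
  have hBz := aux_bessel_pos p hp0 κz hκz
  have hCy : 0 < vmfC (nuOf p) κy := by unfold vmfC; positivity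
  have hCz : 0 < vmfC (nuOf p) κz := by unfold vmfC; positivity
  have hint : ∀ x : EuclideanSpace ℝ (Fin p),
      (vmf p κy μy x * vmf p κz μz x) ^ ((1 : ℝ) / 2)
      = Real.exp ⟪(κy / 2) • μy + (κz / 2) • μz, x⟫
        / (vmfC (nuOf p) κy ^ ((1 : ℝ) / 2) * vmfC (nuOf p) κz ^ ((1 : ℝ) / 2)) := by
    intro x
    unfold vmf
    rw [div_mul_div_comm, ← Real.exp_add, Real.div_rpow (Real.exp_pos _).le (by positivity),
      Real.mul_rpow hCy.le hCz.le, ← Real.exp_mul, inner_add_left, inner_smul_left,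
      inner_smul_left]
    congr 2
    simp
    ring
  unfold hellingerSq
  simp_rw [hint]
  rw [integral_div, aux_vmfC p hp0 _ (by rw [← hκh]; exact hκhpos), ← hκh]
  congr 2
  unfold vmfC
  have hP : (0 : ℝ) < (2 * π) ^ (nuOf p + 1) := by positivity
  have hA : ∀ κ : ℝ, 0 < κ → 0 < besselI (nuOf p) κ →
      ((2 * π) ^ (nuOf p + 1) * besselI (nuOf p) κ / κ ^ nuOf p) ^ ((1 : ℝ) / 2)
      = √((2 * π) ^ (nuOf p + 1)) * besselI (nuOf p) κ ^ ((1 : ℝ) / 2) / κ ^ (nuOf p / 2) := by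
    intro κ hκ hB
    rw [Real.div_rpow (by positivity) (by positivity), Real.mul_rpow hP.le hB.le,
      ← Real.rpow_mul hκ.le, ← Real.sqrt_eq_rpow]
    congr 2
    ring
  rw [hA κy hκy hBy, hA κz hκz hBz]
  have hS : (2 * π) ^ (nuOf p + 1) = √((2 * π) ^ (nuOf p + 1)) * √((2 * π) ^ (nuOf p + 1)) :=
    (Real.mul_self_sqrt hP.le).symm
  have hS0 : 0 < √((2 * π) ^ (nuOf p + 1)) := Real.sqrt_pos.2 hP
  generalize √((2 * π) ^ (nuOf p + 1)) = s at hS hS0 ⊢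
  rw [hS]
  have h1 : 0 < κy ^ (nuOf p / 2) := by positivity
  have h2 : 0 < κz ^ (nuOf p / 2) := by positivity
  have h3 : 0 < κh ^ nuOf p := by positivity
  have h4 : 0 < besselI (nuOf p) κy ^ ((1 : ℝ) / 2) := by positivity
  have h5 : 0 < besselI (nuOf p) κz ^ ((1 : ℝ) / 2) := by positivity
  generalize κy ^ (nuOf p / 2) = a at *
  generalize κz ^ (nuOf p / 2) = b at *
  generalize κh ^ nuOf p = c at *
  generalize besselI (nuOf p) κy ^ ((1 : ℝ) / 2) = d at *
  generalize besselI (nuOf p) κz ^ ((1 : ℝ) / 2) = e at *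
  field_simp
end

section
/- Let y and z be von Mises–Fisher random vectors on S_p with parameters (κ_y, μ_y) and (κ_z, μ_z). Then the Kullback–Leibler divergence of y from z equals d_ℓ(y,z) = ν·ln(κ_y/κ_z) − ln(I_ν(κ_y)/I_ν(κ_z)) + r_ν(κ_y)·⟨κ_y μ_y − κ_z μ_z, μ_y⟩, where r_ν(κ) = I_{ν+1}(κ)/I_ν(κ). -/
open MeasureTheory Real
open scoped RealInnerProductSpace

/-- The Kullback–Leibler divergence of `f_p(·;κ_y,μ_y)` from `f_p(·;κ_z,μ_z)`. -/
noncomputable def klDiv (p : ℕ) (κy κz : ℝ) (μy μz : EuclideanSpace ℝ (Fin p)) : ℝ :=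
  ∫ x : Metric.sphere (0 : EuclideanSpace ℝ (Fin p)) 1,
    Real.log (vmf p κy μy (x : EuclideanSpace ℝ (Fin p))
        / vmf p κz μz (x : EuclideanSpace ℝ (Fin p)))
      * vmf p κy μy (x : EuclideanSpace ℝ (Fin p)) ∂(sphereMeasure p)

lemma polar_prod (p : ℕ) (hp : 2 ≤ p) (g : EuclideanSpace ℝ (Fin p) → ℝ) (h : ℝ → ℝ) :
    ∫ x : EuclideanSpace ℝ (Fin p), g (‖x‖⁻¹ • x) * h ‖x‖
      = (∫ x : Metric.sphere (0 : EuclideanSpace ℝ (Fin p)) 1, g x ∂(sphereMeasure p))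
        * ∫ r in Set.Ioi (0 : ℝ), r ^ (p - 1) * h r := by
  have : Nonempty (Fin p) := ⟨⟨0, by omega⟩⟩
  have hd : Module.finrank ℝ (EuclideanSpace ℝ (Fin p)) = p := by simp
  calc ∫ x : EuclideanSpace ℝ (Fin p), g (‖x‖⁻¹ • x) * h ‖x‖
      = ∫ x : ({(0)}ᶜ : Set (EuclideanSpace ℝ (Fin p))),
          g (‖x.1‖⁻¹ • x.1) * h ‖x.1‖ ∂(Measure.comap Subtype.val volume) := by
        rw [integral_subtype_comap (measurableSet_singleton _).compl
          fun x : EuclideanSpace ℝ (Fin p) ↦ g (‖x‖⁻¹ • x) * h ‖x‖, restrict_compl_singleton]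
    _ = ∫ x, g x.1 * h x.2 ∂(volume : Measure (EuclideanSpace ℝ (Fin p))).toSphere.prod
          (.volumeIoiPow (Module.finrank ℝ (EuclideanSpace ℝ (Fin p)) - 1)) := by
        simpa using (volume : Measure
          (EuclideanSpace ℝ (Fin p))).measurePreserving_homeomorphUnitSphereProd.integral_comp
          (Homeomorph.measurableEmbedding _) (fun x => g x.1.1 * h x.2.1)
    _ = (∫ x : Metric.sphere (0 : EuclideanSpace ℝ (Fin p)) 1, g x ∂(sphereMeasure p)) *
          ∫ x : Set.Ioi (0 : ℝ), h x ∂.volumeIoiPow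
            (Module.finrank ℝ (EuclideanSpace ℝ (Fin p)) - 1) :=
        integral_prod_mul (fun x : Metric.sphere (0 : EuclideanSpace ℝ (Fin p)) 1 => g x)
          (fun x : Set.Ioi (0 : ℝ) => h x)
    _ = _ := by
      congr 1
      rw [hd]
      simp only [Measure.volumeIoiPow, ENNReal.ofReal]
      rw [integral_withDensity_eq_integral_smul,
        integral_subtype_comap measurableSet_Ioi fun a ↦ Real.toNNReal (a ^ (p - 1)) • h a,
        setIntegral_congr_fun measurableSet_Ioi fun x hx ↦ ?_]
      · rw [NNReal.smul_def, Real.coe_toNNReal _ (pow_nonneg hx.out.le _), smul_eq_mul]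
      · exact (measurable_subtype_coe.pow_const _).real_toNNReal

lemma radial_int (n : ℕ) :
    ∫ r in Set.Ioi (0 : ℝ), r ^ n * Real.exp (-r ^ 2) = Real.Gamma (((n : ℝ) + 1) / 2) / 2 := by
  have := integral_rpow_mul_exp_neg_rpow (p := 2) (q := n) (by norm_num)
    (by have : (0 : ℝ) ≤ n := n.cast_nonneg
        linarith)
  simp only [Real.rpow_natCast, Real.rpow_two] at this
  rw [this]; ring

lemma sphere_inv (p : ℕ) (hp : 2 ≤ p) (g : EuclideanSpace ℝ (Fin p) → ℝ)
    (A : EuclideanSpace ℝ (Fin p) ≃ₗᵢ[ℝ] EuclideanSpace ℝ (Fin p)) :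
    ∫ x : Metric.sphere (0 : EuclideanSpace ℝ (Fin p)) 1, g (A x) ∂(sphereMeasure p)
      = ∫ x : Metric.sphere (0 : EuclideanSpace ℝ (Fin p)) 1, g x ∂(sphereMeasure p) := by
  have h1 := polar_prod p hp (fun x => g (A x)) (fun r => Real.exp (-r ^ 2))
  have h2 := polar_prod p hp g (fun r => Real.exp (-r ^ 2))
  have h3 := A.measurePreserving.integral_comp A.toHomeomorph.measurableEmbedding
    (fun x => g (‖x‖⁻¹ • x) * Real.exp (-‖x‖ ^ 2))
  simp only [LinearIsometryEquiv.norm_map] at h3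
  simp only [map_smul] at h1
  rw [h3, h2, radial_int] at h1
  refine (mul_right_cancel₀ ?_ h1).symm
  have : 0 < Real.Gamma (((p - 1 : ℕ) + 1 : ℝ) / 2) := Real.Gamma_pos_of_pos (by positivity)
  positivity

lemma gauss_even (k : ℕ) :
    ∫ x : ℝ, x ^ (2 * k) * Real.exp (-x ^ 2) = Real.Gamma (k + 1 / 2) := by
  have := integral_comp_abs (f := fun x : ℝ => x ^ (2 * k) * Real.exp (-x ^ 2))
  simp only [sq_abs, pow_mul] at this
  simp only [pow_mul]
  rw [this]
  simp only [← pow_mul]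
  rw [radial_int]
  push_cast
  rw [show ((2 : ℝ) * k + 1) / 2 = k + 1 / 2 by ring]
  ring

lemma gauss_coord (p : ℕ) (i : Fin p) (k : ℕ) :
    ∫ x : EuclideanSpace ℝ (Fin p), (x i) ^ (2 * k) * Real.exp (-‖x‖ ^ 2)
      = Real.Gamma (k + 1 / 2) * (√π) ^ (p - 1) := by
  rw [← (PiLp.volume_preserving_toLp (Fin p)).integral_comp
    (MeasurableEquiv.toLp 2 _).measurableEmbedding]
  have : ∀ x : Fin p → ℝ, ((WithLp.toLp 2 x : EuclideanSpace ℝ (Fin p)) i) ^ (2 * k) *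
      Real.exp (-‖(WithLp.toLp 2 x : EuclideanSpace ℝ (Fin p))‖ ^ 2)
      = ∏ j, (fun j (y : ℝ) => (if j = i then y ^ (2 * k) else 1) * Real.exp (-y ^ 2)) j (x j) := by
    intro x
    rw [EuclideanSpace.norm_sq_eq]
    simp only [Finset.prod_mul_distrib, ← Real.exp_sum, Finset.prod_ite_eq', Finset.mem_univ,
      if_true, Real.norm_eq_abs, sq_abs, Finset.sum_neg_distrib]
  simp_rw [this]
  rw [integral_fintype_prod_volume_eq_prod
    (f := fun j (y : ℝ) => (if j = i then y ^ (2 * k) else 1) * Real.exp (-y ^ 2))]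
  rw [← Finset.mul_prod_erase _ _ (Finset.mem_univ i)]
  congr 1
  · simp only [if_true]; exact gauss_even k
  · rw [Finset.prod_congr rfl (g := fun _ => √π)]
    · simp
    · intro j hj
      have h0 := gauss_even 0
      simp only [Finset.ne_of_mem_erase hj, if_false]
      rw [Nat.cast_zero, zero_add, Real.Gamma_one_half_eq] at h0
      simpa using h0

lemma moment_even (p : ℕ) (hp : 2 ≤ p) (μ : EuclideanSpace ℝ (Fin p)) (hμ : ‖μ‖ = 1) (k : ℕ) :
    ∫ x : Metric.sphere (0 : EuclideanSpace ℝ (Fin p)) 1, ⟪μ, (x : EuclideanSpace ℝ (Fin p))⟫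
      ^ (2 * k) ∂(sphereMeasure p)
      = 2 * π ^ (nuOf p + 1) * ((2 * k).factorial / (4 ^ k * k.factorial)) /
        Real.Gamma (nuOf p + k + 1) := by
  let i : Fin p := ⟨0, by omega⟩
  let e : EuclideanSpace ℝ (Fin p) := EuclideanSpace.single i 1
  have he : ‖e‖ = 1 := by simp [e]
  let A := (ℝ ∙ (μ - e))ᗮ.reflection
  have hA : A μ = e := Submodule.reflection_sub (by rw [hμ, he])
  have h1 : ∀ x, ⟪μ, x⟫ = (A x) i := by
    intro x
    rw [← A.inner_map_map, hA]
    simp [e, EuclideanSpace.inner_single_left]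
  simp only [h1]
  rw [sphere_inv p hp (fun x => (x i) ^ (2 * k)) A]
  have h2 := polar_prod p hp (fun x => (x i) ^ (2 * k)) (fun r => r ^ (2 * k) * Real.exp (-r ^ 2))
  have h3 : ∀ x : EuclideanSpace ℝ (Fin p), ((‖x‖⁻¹ • x) i) ^ (2 * k) *
      (‖x‖ ^ (2 * k) * Real.exp (-‖x‖ ^ 2)) = (x i) ^ (2 * k) * Real.exp (-‖x‖ ^ 2) := by
    intro x
    by_cases hx : x = 0
    · subst hx
      rcases Nat.eq_zero_or_pos k with rfl | hk
      · simp
      · have : 2 * k ≠ 0 := by omega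
        simp [this]
    · have : ‖x‖ ≠ 0 := norm_ne_zero_iff.mpr hx
      simp only [PiLp.smul_apply, smul_eq_mul, mul_pow, inv_pow]
      field_simp
  simp only [h3, gauss_coord, ← mul_assoc, ← pow_add, radial_int] at h2
  have hG := Real.Gamma_mul_Gamma_add_half ((k : ℝ) + 1 / 2)
  rw [show (k : ℝ) + 1 / 2 + 1 / 2 = k + 1 by ring, Real.Gamma_nat_eq_factorial,
    show 2 * ((k : ℝ) + 1 / 2) = (2 * k : ℕ) + 1 by push_cast; ring, Real.Gamma_nat_eq_factorial,
    show 1 - (((2 * k : ℕ) : ℝ) + 1) = - ((2 * k : ℕ) : ℝ) by ring, Real.rpow_neg (by norm_num),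
    Real.rpow_natCast, pow_mul] at hG
  have hk : (k.factorial : ℝ) ≠ 0 := by positivity
  have hG' : Real.Gamma (k + 1 / 2) = (2 * k).factorial * √π / (4 ^ k * k.factorial) := by
    rw [eq_div_iff (by positivity)]
    rw [show (2 : ℝ) ^ 2 = 4 by norm_num] at hG
    have h4 : (4 : ℝ) ^ k ≠ 0 := by positivity
    rw [← mul_assoc, mul_right_comm, hG]
    field_simp
  have hpi : π ^ (nuOf p + 1) = √π * √π ^ (p - 1) := by
    rw [← pow_succ', Nat.sub_add_cancel (by omega), Real.sqrt_eq_rpow, ← Real.rpow_natCast,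
      ← Real.rpow_mul pi_pos.le]
    congr 1; simp only [nuOf]; ring
  have harg : (((p - 1 + 2 * k : ℕ) : ℝ) + 1) / 2 = nuOf p + k + 1 := by
    rw [Nat.cast_add, Nat.cast_sub (by omega)]; push_cast; simp only [nuOf]; ring
  rw [harg, hG'] at h2
  have hpos : 0 < Real.Gamma (nuOf p + k + 1) := by
    apply Real.Gamma_pos_of_pos; rw [← harg]; positivity
  rw [hpi, eq_div_iff hpos.ne']
  linear_combination -2 * h2

lemma moment_odd (p : ℕ) (hp : 2 ≤ p) (μ : EuclideanSpace ℝ (Fin p)) (n : ℕ) (hn : Odd n) :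
    ∫ x : Metric.sphere (0 : EuclideanSpace ℝ (Fin p)) 1, ⟪μ, (x : EuclideanSpace ℝ (Fin p))⟫
      ^ n ∂(sphereMeasure p) = 0 := by
  have := sphere_inv p hp (fun x => ⟪μ, x⟫ ^ n) (LinearIsometryEquiv.neg ℝ)
  simp only [LinearIsometryEquiv.coe_neg, inner_neg_right, hn.neg_pow, integral_neg] at this
  linarith

instance (p : ℕ) : IsFiniteMeasure (sphereMeasure p) := by
  unfold sphereMeasure; infer_instance

lemma sphere_integrable (p : ℕ) (g : EuclideanSpace ℝ (Fin p) → ℝ) (hg : Continuous g) :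
    Integrable (fun x : Metric.sphere (0 : EuclideanSpace ℝ (Fin p)) 1 => g x)
      (sphereMeasure p) :=
  (hg.comp continuous_subtype_val).integrable_of_hasCompactSupport
    (HasCompactSupport.of_compactSpace _)

/-- Termwise integration of the exponential series, with an extra factor. -/
lemma series_exp (p : ℕ) (μ : EuclideanSpace ℝ (Fin p)) (hμ : ‖μ‖ = 1) (κ : ℝ) (m : ℕ) :
    HasSum (fun n : ℕ => κ ^ n / n.factorial *
      ∫ x : Metric.sphere (0 : EuclideanSpace ℝ (Fin p)) 1, ⟪μ, (x : EuclideanSpace ℝ (Fin p))⟫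
        ^ (n + m) ∂(sphereMeasure p))
      (∫ x : Metric.sphere (0 : EuclideanSpace ℝ (Fin p)) 1,
        ⟪μ, (x : EuclideanSpace ℝ (Fin p))⟫ ^ m *
        Real.exp (κ * ⟪μ, (x : EuclideanSpace ℝ (Fin p))⟫) ∂(sphereMeasure p)) := by
  simp only [← integral_const_mul]
  refine hasSum_integral_of_dominated_convergence (fun n _ => |κ| ^ n / n.factorial) ?_ ?_ ?_ ?_ ?_
  · intro n
    exact (sphere_integrable p (fun x => κ ^ n / n.factorial * ⟪μ, x⟫ ^ (n + m))
      (by fun_prop)).aestronglyMeasurable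
  · intro n
    refine Filter.Eventually.of_forall fun x => ?_
    have hx : |⟪μ, (x : EuclideanSpace ℝ (Fin p))⟫| ≤ 1 := by
      have := abs_real_inner_le_norm μ (x : EuclideanSpace ℝ (Fin p))
      simpa [hμ] using this
    rw [Real.norm_eq_abs, abs_mul, abs_div, abs_pow, abs_pow, Nat.abs_cast]
    exact mul_le_of_le_one_right (by positivity) (pow_le_one₀ (abs_nonneg _) hx)
  · exact Filter.Eventually.of_forall fun x => Real.summable_pow_div_factorial _
  · exact integrable_const _
  · refine Filter.Eventually.of_forall fun x => ?_
    have := (NormedSpace.expSeries_div_hasSum_exp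
      (κ * ⟪μ, (x : EuclideanSpace ℝ (Fin p))⟫)).mul_left (⟪μ, (x : EuclideanSpace ℝ (Fin p))⟫ ^ m)
    rw [← Real.exp_eq_exp_ℝ] at this
    have he : (fun n : ℕ => κ ^ n / n.factorial * ⟪μ, (x : EuclideanSpace ℝ (Fin p))⟫ ^ (n + m))
        = fun n : ℕ => ⟪μ, (x : EuclideanSpace ℝ (Fin p))⟫ ^ m *
          ((κ * ⟪μ, (x : EuclideanSpace ℝ (Fin p))⟫) ^ n / n.factorial) := by
      ext n; rw [mul_pow, pow_add]; ring
    rw [he]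
    exact this

lemma integral_exp_eq (p : ℕ) (hp : 2 ≤ p) (μ : EuclideanSpace ℝ (Fin p)) (hμ : ‖μ‖ = 1)
    (κ : ℝ) (hκ : 0 < κ) :
    ∫ x : Metric.sphere (0 : EuclideanSpace ℝ (Fin p)) 1,
        Real.exp (κ * ⟪μ, (x : EuclideanSpace ℝ (Fin p))⟫) ∂(sphereMeasure p)
      = vmfC (nuOf p) κ := by
  have h := series_exp p μ hμ κ 0
  simp only [pow_zero, one_mul, add_zero] at h
  have hinj : Function.Injective (fun k : ℕ => 2 * k) := fun a b h => by simpa using h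
  rw [← hinj.hasSum_iff] at h
  · rw [← h.tsum_eq]
    simp only [Function.comp_def, moment_even p hp μ hμ]
    rw [vmfC, besselI, Real.mul_rpow (by norm_num) pi_pos.le, Real.div_rpow hκ.le (by norm_num),
      Real.rpow_add_one (x := 2) (by norm_num) (nuOf p)]
    have h1 : κ ^ nuOf p ≠ 0 := (Real.rpow_pos_of_pos hκ _).ne'
    have h2 : (2 : ℝ) ^ nuOf p ≠ 0 := (Real.rpow_pos_of_pos (by norm_num) _).ne'
    have : ∀ T : ℝ, 2 ^ nuOf p * 2 * π ^ (nuOf p + 1) * (κ ^ nuOf p / 2 ^ nuOf p * T) / κ ^ nuOf p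
        = 2 * π ^ (nuOf p + 1) * T := by intro T; field_simp
    rw [this, ← tsum_mul_left]
    congr 1; ext k
    have h3 : ((2 * k).factorial : ℝ) ≠ 0 := by positivity
    rw [div_pow, pow_mul 2 2 k]
    norm_num
    field_simp
  · intro n hn
    have : Odd n := by
      rw [← Nat.not_even_iff_odd]
      rintro ⟨k, rfl⟩
      exact hn ⟨k, by simp; ring⟩
    rw [moment_odd p hp μ n this, mul_zero]

lemma integral_inner_exp_eq (p : ℕ) (hp : 2 ≤ p) (μ : EuclideanSpace ℝ (Fin p)) (hμ : ‖μ‖ = 1)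
    (κ : ℝ) (hκ : 0 < κ) :
    ∫ x : Metric.sphere (0 : EuclideanSpace ℝ (Fin p)) 1, ⟪μ, (x : EuclideanSpace ℝ (Fin p))⟫ *
        Real.exp (κ * ⟪μ, (x : EuclideanSpace ℝ (Fin p))⟫) ∂(sphereMeasure p)
      = (2 * π) ^ (nuOf p + 1) * besselI (nuOf p + 1) κ / κ ^ nuOf p := by
  have h := series_exp p μ hμ κ 1
  simp only [pow_one] at h
  have hinj : Function.Injective (fun k : ℕ => 2 * k + 1) := fun a b h => by simpa using h
  rw [← hinj.hasSum_iff] at h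
  · rw [← h.tsum_eq]
    simp only [Function.comp_def, show ∀ k, 2 * k + 1 + 1 = 2 * (k + 1) by intro k; ring,
      moment_even p hp μ hμ]
    rw [besselI, Real.mul_rpow (by norm_num) pi_pos.le, Real.div_rpow hκ.le (by norm_num),
      Real.rpow_add_one hκ.ne']
    have h1 : κ ^ nuOf p ≠ 0 := (Real.rpow_pos_of_pos hκ _).ne'
    have h2 : (2 : ℝ) ^ (nuOf p + 1) ≠ 0 := (Real.rpow_pos_of_pos (by norm_num) _).ne'
    have : ∀ T : ℝ, 2 ^ (nuOf p + 1) * π ^ (nuOf p + 1) *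
        (κ ^ nuOf p * κ / 2 ^ (nuOf p + 1) * T) / κ ^ nuOf p
        = π ^ (nuOf p + 1) * κ * T := by intro T; field_simp
    rw [this, ← tsum_mul_left]
    congr 1; ext k
    have h3 : ((2 * k).factorial : ℝ) ≠ 0 := by positivity
    have h4 : (k.factorial : ℝ) ≠ 0 := by positivity
    rw [show 2 * (k + 1) = (2 * k + 1) + 1 by ring, Nat.factorial_succ (2 * k + 1),
      Nat.factorial_succ k, div_pow, pow_mul 2 2 k, pow_succ κ (2 * k),
      show nuOf p + ((k + 1 : ℕ) : ℝ) + 1 = nuOf p + 1 + k + 1 by push_cast; ring, pow_succ 4 k]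
    have h5 : ((2 * k + 1).factorial : ℝ) ≠ 0 := by positivity
    push_cast
    norm_num
    field_simp
    ring
  · intro n hn
    have : Odd (n + 1) := by
      rw [← Nat.not_even_iff_odd]
      rintro ⟨k, hk⟩
      exact hn ⟨k - 1, by simp; omega⟩
    rw [moment_odd p hp μ _ this, mul_zero]

lemma integral_inner_exp_perp (p : ℕ) (hp : 2 ≤ p) (μ w : EuclideanSpace ℝ (Fin p))
    (hw : ⟪w, μ⟫ = 0) (κ : ℝ) :
    ∫ x : Metric.sphere (0 : EuclideanSpace ℝ (Fin p)) 1, ⟪w, (x : EuclideanSpace ℝ (Fin p))⟫ *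
        Real.exp (κ * ⟪μ, (x : EuclideanSpace ℝ (Fin p))⟫) ∂(sphereMeasure p) = 0 := by
  let A := (ℝ ∙ w)ᗮ.reflection
  have hAw : A w = -w := Submodule.reflection_orthogonalComplement_singleton_eq_neg w
  have hAμ : A μ = μ := Submodule.reflection_mem_subspace_eq_self
    (Submodule.mem_orthogonal_singleton_iff_inner_right.mpr hw)
  have h1 : ∀ x, ⟪μ, A x⟫ = ⟪μ, x⟫ := fun x => by
    conv_lhs => rw [← hAμ]
    exact A.inner_map_map _ _
  have h2 : ∀ x, ⟪w, A x⟫ = -⟪w, x⟫ := fun x => by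
    have := A.inner_map_map w x
    rw [hAw, inner_neg_left] at this
    linarith
  have := sphere_inv p hp (fun x => ⟪w, x⟫ * Real.exp (κ * ⟪μ, x⟫)) A
  simp only [h1, h2, neg_mul, integral_neg] at this
  linarith

lemma integral_inner_exp (p : ℕ) (hp : 2 ≤ p) (μ w : EuclideanSpace ℝ (Fin p)) (hμ : ‖μ‖ = 1)
    (κ : ℝ) (hκ : 0 < κ) :
    ∫ x : Metric.sphere (0 : EuclideanSpace ℝ (Fin p)) 1, ⟪w, (x : EuclideanSpace ℝ (Fin p))⟫ *
        Real.exp (κ * ⟪μ, (x : EuclideanSpace ℝ (Fin p))⟫) ∂(sphereMeasure p)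
      = ⟪w, μ⟫ * ((2 * π) ^ (nuOf p + 1) * besselI (nuOf p + 1) κ / κ ^ nuOf p) := by
  have h0 : ⟪w - ⟪w, μ⟫ • μ, μ⟫ = 0 := by
    rw [inner_sub_left, inner_smul_left, real_inner_self_eq_norm_sq, hμ]; simp
  have h1 := integral_inner_exp_perp p hp μ _ h0 κ
  simp only [inner_sub_left, inner_smul_left, sub_mul] at h1
  rw [integral_sub (sphere_integrable p (fun x => ⟪w, x⟫ * Real.exp (κ * ⟪μ, x⟫)) (by fun_prop))
    (sphere_integrable p (fun x => _ * ⟪μ, x⟫ * Real.exp (κ * ⟪μ, x⟫)) (by fun_prop))] at h1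
  simp only [mul_assoc, integral_const_mul] at h1
  rw [integral_inner_exp_eq p hp μ hμ κ hκ] at h1
  simp at h1
  linarith

lemma vmfC_pos_s13 (p : ℕ) (hp : 2 ≤ p) (μ : EuclideanSpace ℝ (Fin p)) (hμ : ‖μ‖ = 1)
    (κ : ℝ) (hκ : 0 < κ) : 0 < vmfC (nuOf p) κ := by
  rw [← integral_exp_eq p hp μ hμ κ hκ]
  have : Nonempty (Fin p) := ⟨⟨0, by omega⟩⟩
  have : NeZero (sphereMeasure p) := ⟨Measure.toSphere_ne_zero _⟩
  exact integral_exp_pos (sphere_integrable p (fun x => Real.exp (κ * ⟪μ, x⟫)) (by fun_prop))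

/-- Kullback–Leibler divergence between two von Mises–Fisher distributions. -/
theorem kl_divergence_vmf (p : ℕ) (hp : 2 ≤ p)
    (κy κz : ℝ) (hκy : 0 < κy) (hκz : 0 < κz)
    (μy μz : EuclideanSpace ℝ (Fin p)) (hμy : ‖μy‖ = 1) (hμz : ‖μz‖ = 1) :
    klDiv p κy κz μy μz
      = nuOf p * Real.log (κy / κz)
        - Real.log (besselI (nuOf p) κy / besselI (nuOf p) κz)
        + besselRatio (nuOf p) κy * ⟪κy • μy - κz • μz, μy⟫ := by
  have hCy := vmfC_pos_s13 p hp μy hμy κy hκy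
  have hCz := vmfC_pos_s13 p hp μz hμz κz hκz
  have hpi : 0 < (2 * π) ^ (nuOf p + 1) := Real.rpow_pos_of_pos (by positivity) _
  have hy : 0 < κy ^ nuOf p := Real.rpow_pos_of_pos hκy _
  have hz : 0 < κz ^ nuOf p := Real.rpow_pos_of_pos hκz _
  have hB : ∀ κ, 0 < κ → 0 < vmfC (nuOf p) κ → 0 < besselI (nuOf p) κ := by
    intro κ hκ h
    have hκ' : 0 < κ ^ nuOf p := Real.rpow_pos_of_pos hκ _
    have : besselI (nuOf p) κ = vmfC (nuOf p) κ * κ ^ nuOf p / (2 * π) ^ (nuOf p + 1) := by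
      rw [vmfC]; field_simp
    rw [this]; positivity
  have hBy := hB κy hκy hCy
  have hBz := hB κz hκz hCz
  have hlog : Real.log (vmfC (nuOf p) κz / vmfC (nuOf p) κy) = nuOf p * Real.log (κy / κz)
        - Real.log (besselI (nuOf p) κy / besselI (nuOf p) κz) := by
    rw [Real.log_div hCz.ne' hCy.ne', Real.log_div hκy.ne' hκz.ne', Real.log_div hBy.ne' hBz.ne',
      vmfC, vmfC, Real.log_div (by positivity) hz.ne', Real.log_div (by positivity) hy.ne',
      Real.log_mul hpi.ne' hBz.ne', Real.log_mul hpi.ne' hBy.ne', Real.log_rpow hκy,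
      Real.log_rpow hκz]
    ring
  have hint : ∀ x : EuclideanSpace ℝ (Fin p),
      Real.log (vmf p κy μy x / vmf p κz μz x) * vmf p κy μy x
      = (vmfC (nuOf p) κy)⁻¹ * (Real.log (vmfC (nuOf p) κz / vmfC (nuOf p) κy) *
          Real.exp (κy * ⟪μy, x⟫) + ⟪κy • μy - κz • μz, x⟫ * Real.exp (κy * ⟪μy, x⟫)) := by
    intro x
    have : vmf p κy μy x / vmf p κz μz x
        = vmfC (nuOf p) κz / vmfC (nuOf p) κy * Real.exp (κy * ⟪μy, x⟫ - κz * ⟪μz, x⟫) := by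
      rw [vmf, vmf, Real.exp_sub]; field_simp
    rw [this, Real.log_mul (by positivity) (Real.exp_pos _).ne', Real.log_exp, vmf,
      inner_sub_left, real_inner_smul_left, real_inner_smul_left]
    ring
  simp only [klDiv, hint]
  rw [integral_const_mul, integral_add
    (sphere_integrable p (fun x => _ * Real.exp (κy * ⟪μy, x⟫)) (by fun_prop))
    (sphere_integrable p (fun x => ⟪κy • μy - κz • μz, x⟫ * Real.exp (κy * ⟪μy, x⟫))
      (by fun_prop)), integral_const_mul,
    integral_exp_eq p hp μy hμy κy hκy, integral_inner_exp p hp μy _ hμy κy hκy, ← hlog]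
  have hr : (2 * π) ^ (nuOf p + 1) * besselI (nuOf p + 1) κy / κy ^ nuOf p
      = vmfC (nuOf p) κy * besselRatio (nuOf p) κy := by
    rw [vmfC, besselRatio]; field_simp
  rw [hr]
  field_simp
end
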